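/- Let μ be a positive measure on (0,∞) with ∫ s dμ(s) = m for some m ∈ (0,1/2), and with ∫ dμ(s) ≤ C and ∫ s² dμ(s) ≤ C for some C > 0, and set F₀(x) = ∫_{(0,∞)} (1 − e^{−s·x}) dμ(s) for x ≥ 0. Let F be the function that is Lipschitz on [0,∞)×[0,∞), sublinear in x, satisfies 0 ≤ F(x,t) ≤ m·x, F(x,0) = F₀(x), and is a viscosity solution of (HJ) on (0,∞)×(0,∞). Then F ∈ C^∞((0,∞)×(0,∞)) ∩ C¹([0,∞)×[0,∞)). -/

import Mathlib

open Set Filter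

/-- A function `ψ : [0,∞) → ℝ` is sublinear if `ψ(x)/x → 0` as `x → ∞`. -/
def Sublinear (ψ : ℝ → ℝ) : Prop :=
  Tendsto (fun x => ψ x / x) atTop (nhds 0)

/-- `F` is sublinear in `x` if `x ↦ F(x,t)` is sublinear for each `t ≥ 0`. -/
def SublinearInX (F : ℝ → ℝ → ℝ) : Prop :=
  ∀ t, 0 ≤ t → Sublinear (fun x => F x t)

/-- Viscosity subsolution of
`∂ₜF + (1/2)(∂ₓF − m)(∂ₓF − m − 1) + F/x − m = 0` on `(0,∞) × (0,∞)`. -/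
def IsSubsolutionHJ (m : ℝ) (F : ℝ → ℝ → ℝ) : Prop :=
  ∀ φ : ℝ × ℝ → ℝ, ContDiff ℝ 1 φ →
    ∀ x₀ t₀ : ℝ, 0 < x₀ → 0 < t₀ →
      IsLocalMaxOn (fun p : ℝ × ℝ => F p.1 p.2 - φ p) (Ici 0 ×ˢ Ici 0) (x₀, t₀) →
      deriv (fun s => φ (x₀, s)) t₀ +
        (1 / 2) * (deriv (fun y => φ (y, t₀)) x₀ - m) *
          (deriv (fun y => φ (y, t₀)) x₀ - m - 1) +
        F x₀ t₀ / x₀ - m ≤ 0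

/-- Viscosity supersolution of
`∂ₜF + (1/2)(∂ₓF − m)(∂ₓF − m − 1) + F/x − m = 0` on `(0,∞) × (0,∞)`. -/
def IsSupersolutionHJ (m : ℝ) (F : ℝ → ℝ → ℝ) : Prop :=
  ∀ φ : ℝ × ℝ → ℝ, ContDiff ℝ 1 φ →
    ∀ x₀ t₀ : ℝ, 0 < x₀ → 0 < t₀ →
      IsLocalMinOn (fun p : ℝ × ℝ => F p.1 p.2 - φ p) (Ici 0 ×ˢ Ici 0) (x₀, t₀) →
      deriv (fun s => φ (x₀, s)) t₀ +
        (1 / 2) * (deriv (fun y => φ (y, t₀)) x₀ - m) *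
          (deriv (fun y => φ (y, t₀)) x₀ - m - 1) +
        F x₀ t₀ / x₀ - m ≥ 0

/-- Viscosity solution of (HJ). -/
def IsSolutionHJ (m : ℝ) (F : ℝ → ℝ → ℝ) : Prop :=
  IsSubsolutionHJ m F ∧ IsSupersolutionHJ m F

/-- A Lipschitz (on the quadrant), sublinear-in-`x` viscosity solution of (HJ)
with `0 ≤ F(x,t) ≤ m·x` and initial data `F₀`. -/
def GoodSolution (m : ℝ) (F₀ : ℝ → ℝ) (F : ℝ → ℝ → ℝ) : Prop :=
  (∃ K : NNReal, LipschitzOnWith K (fun p : ℝ × ℝ => F p.1 p.2) (Ici 0 ×ˢ Ici 0)) ∧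
  SublinearInX F ∧
  (∀ x t : ℝ, 0 ≤ x → 0 ≤ t → 0 ≤ F x t ∧ F x t ≤ m * x) ∧
  (∀ x : ℝ, 0 ≤ x → F x 0 = F₀ x) ∧
  IsSolutionHJ m F

open MeasureTheory

section VolterraOperators

variable {E : Type*} [NormedAddCommGroup E] [NormedSpace ℝ E] [CompleteSpace E]

open scoped unitInterval Nat

/-- Integration from `0`, as a bounded operator on continuous functions on the unit interval. -/
noncomputable def primitiveCLM (E : Type*) [NormedAddCommGroup E] [NormedSpace ℝ E]
    [CompleteSpace E] : C(I, E) →L[ℝ] C(I, E) :=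
  LinearMap.mkContinuous
    { toFun := fun v => ⟨fun s => ∫ z in (0 : ℝ)..s, v (projIcc 0 1 zero_le_one z), by
        have h : Continuous fun s : ℝ => ∫ z in (0 : ℝ)..s, v (projIcc 0 1 zero_le_one z) :=
          intervalIntegral.continuous_primitive
            (fun a b => (by fun_prop : Continuous fun z : ℝ =>
              v (projIcc 0 1 zero_le_one z)).intervalIntegrable a b) 0
        exact h.comp continuous_subtype_val⟩
      map_add' := fun u v => by
        ext s
        simp only [ContinuousMap.coe_mk, ContinuousMap.add_apply]
        exact intervalIntegral.integral_add
          ((by fun_prop : Continuous fun z : ℝ =>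
              u (projIcc 0 1 zero_le_one z)).intervalIntegrable _ _)
          ((by fun_prop : Continuous fun z : ℝ =>
              v (projIcc 0 1 zero_le_one z)).intervalIntegrable _ _)
      map_smul' := fun c v => by
        ext s
        simp }
    1 (fun v => by
      rw [one_mul, ContinuousMap.norm_le _ (norm_nonneg v)]
      intro s
      have := intervalIntegral.norm_integral_le_of_norm_le_const (a := 0) (b := (s : ℝ))
        (f := fun z => v (projIcc 0 1 zero_le_one z)) (C := ‖v‖)
        (fun z _ => v.norm_coe_le_norm _)
      refine this.trans ?_
      rw [sub_zero, abs_of_nonneg s.2.1]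
      exact mul_le_of_le_one_right (norm_nonneg v) s.2.2)

theorem primitiveCLM_apply (v : C(I, E)) (s : I) :
    primitiveCLM E v s = ∫ z in (0 : ℝ)..s, v (projIcc 0 1 zero_le_one z) := rfl

theorem norm_iterate_volterra_le (M : C(I, E) →L[ℝ] C(I, E)) (c : ℝ) (hc : 0 ≤ c)
    (hM : ∀ v s, ‖M v s‖ ≤ c * ‖v s‖) (n : ℕ) (v : C(I, E)) (s : I) :
    ‖((primitiveCLM E ∘L M) ^ n) v s‖ ≤ (c * s) ^ n / n ! * ‖v‖ := by
  induction n generalizing s with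
  | zero => simpa using v.norm_coe_le_norm s
  | succ n ih =>
    rw [pow_succ']
    change ‖primitiveCLM E (M (((primitiveCLM E ∘L M) ^ n) v)) s‖ ≤ _
    set w := ((primitiveCLM E ∘L M) ^ n) v
    rw [primitiveCLM_apply]
    have hint : ∫ z in (0 : ℝ)..s, c * ((c * z) ^ n / n ! * ‖v‖)
        = (c * s) ^ (n + 1) / (n + 1)! * ‖v‖ := by
      have : ∀ z : ℝ, c * ((c * z) ^ n / n ! * ‖v‖) = (c ^ (n + 1) / n ! * ‖v‖) * z ^ n := by
        intro z; rw [mul_pow]; ring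
      simp_rw [this]
      rw [intervalIntegral.integral_const_mul, integral_pow, Nat.factorial_succ]
      push_cast
      have h1 : ((n : ℝ) + 1) ≠ 0 := by positivity
      have h2 : ((n ! : ℕ) : ℝ) ≠ 0 := by positivity
      field_simp
      ring
    rw [← hint]
    refine intervalIntegral.norm_integral_le_of_norm_le s.2.1 ?_ ?_
    · refine Eventually.of_forall fun z hz => ?_
      have h1 : z ∈ Icc (0 : ℝ) 1 := ⟨hz.1.le, hz.2.trans s.2.2⟩
      rw [projIcc_of_mem _ h1]
      exact (hM _ _).trans (mul_le_mul_of_nonneg_left (ih ⟨z, h1⟩) hc)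
    · exact (by fun_prop : Continuous fun z : ℝ =>
        c * ((c * z) ^ n / n ! * ‖v‖)).intervalIntegrable _ _

theorem isUnit_one_sub_volterra (M : C(I, E) →L[ℝ] C(I, E)) (c : ℝ) (hc : 0 ≤ c)
    (hM : ∀ v s, ‖M v s‖ ≤ c * ‖v s‖) : IsUnit (1 - primitiveCLM E ∘L M) := by
  obtain ⟨n, hn⟩ : ∃ n : ℕ, c ^ n / n ! < 1 :=
    ((FloorSemiring.tendsto_pow_div_factorial_atTop c).eventually_lt_const zero_lt_one).exists
  have hnorm : ‖(primitiveCLM E ∘L M) ^ n‖ < 1 := by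
    refine lt_of_le_of_lt (ContinuousLinearMap.opNorm_le_bound _ (by positivity) fun v => ?_) hn
    rw [ContinuousMap.norm_le _ (by positivity)]
    intro s
    refine (norm_iterate_volterra_le M c hc hM n v s).trans ?_
    have : c * s ≤ c := mul_le_of_le_one_right hc s.2.2
    have h0 : 0 ≤ c * s := mul_nonneg hc s.2.1
    gcongr
  have hu : IsUnit (1 - (primitiveCLM E ∘L M) ^ n) :=
    isUnit_one_sub_of_norm_lt_one (R := C(I, E) →L[ℝ] C(I, E)) hnorm
  rw [← mul_neg_geom_sum] at hu
  refine ((Commute.isUnit_mul_iff ?_).1 hu).1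
  exact (Commute.sum_right _ _ _ fun i _ => (Commute.one_left _).sub_left
    ((Commute.refl _).pow_right i))

end VolterraOperators

section SmoothDependence

variable {E : Type*} [NormedAddCommGroup E] [NormedSpace ℝ E]

open scoped unitInterval Topology ContDiff

/-- Pointwise application of a continuous bilinear map to continuous functions. -/
noncomputable def pointwiseBilin (B : E →L[ℝ] E →L[ℝ] E) :
    C(I, E) →L[ℝ] C(I, E) →L[ℝ] C(I, E) :=
  LinearMap.mkContinuous₂
    (LinearMap.mk₂ ℝ (fun u v : C(I, E) => (⟨fun s => B (u s) (v s), by fun_prop⟩ : C(I, E)))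
      (fun u u' v => by ext s; simp) (fun a u v => by ext s; simp)
      (fun u v v' => by ext s; simp) (fun a u v => by ext s; simp))
    ‖B‖ (fun u v => by
      rw [ContinuousMap.norm_le _ (by positivity)]
      intro s
      refine (B.le_opNorm₂ _ _).trans ?_
      gcongr
      · exact u.norm_coe_le_norm s
      · exact v.norm_coe_le_norm s)

theorem pointwiseBilin_apply (B : E →L[ℝ] E →L[ℝ] E) (u v : C(I, E)) (s : I) :
    pointwiseBilin B u v s = B (u s) (v s) := rfl

/-- Pointwise application of a continuous linear map to continuous functions. -/
noncomputable def pointwiseLin (L : E →L[ℝ] E) : C(I, E) →L[ℝ] C(I, E) :=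
  LinearMap.mkContinuous
    { toFun := fun u => (⟨fun s => L (u s), by fun_prop⟩ : C(I, E))
      map_add' := fun u v => by ext s; simp
      map_smul' := fun a u => by ext s; simp }
    ‖L‖ (fun u => by
      rw [ContinuousMap.norm_le _ (by positivity)]
      intro s
      refine (L.le_opNorm _).trans ?_
      gcongr
      exact u.norm_coe_le_norm s)

theorem pointwiseLin_apply (L : E →L[ℝ] E) (u : C(I, E)) (s : I) :
    pointwiseLin L u s = L (u s) := rfl

/-- Constant functions, as a bounded linear map. -/
noncomputable def constCLM (E : Type*) [NormedAddCommGroup E] [NormedSpace ℝ E] :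
    E →L[ℝ] C(I, E) :=
  LinearMap.mkContinuous
    { toFun := fun a => ContinuousMap.const I a
      map_add' := fun a b => by ext; simp
      map_smul' := fun c a => by ext; simp }
    1 (fun a => by
      rw [one_mul, ContinuousMap.norm_le _ (norm_nonneg a)]
      intro s
      simp)

theorem constCLM_apply (a : E) (s : I) : constCLM E a s = a := rfl

/-- The superposition operator of the quadratic vector field `w ↦ L w + B w w`. -/
noncomputable def superposition (L : E →L[ℝ] E) (B : E →L[ℝ] E →L[ℝ] E) (w : C(I, E)) : C(I, E) :=
  pointwiseLin L w + pointwiseBilin B w w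

/-- The linear operator with `superposition L B w - superposition L B w'` as its value
at `w - w'`. -/
noncomputable def superpositionSlope (L : E →L[ℝ] E) (B : E →L[ℝ] E →L[ℝ] E) (w w' : C(I, E)) :
    C(I, E) →L[ℝ] C(I, E) :=
  pointwiseLin L + pointwiseBilin B w + (pointwiseBilin B).flip w'

theorem superpositionSlope_apply (L : E →L[ℝ] E) (B : E →L[ℝ] E →L[ℝ] E) (w w' v : C(I, E))
    (s : I) : superpositionSlope L B w w' v s = L (v s) + B (w s) (v s) + B (v s) (w' s) := rfl

theorem superposition_sub (L : E →L[ℝ] E) (B : E →L[ℝ] E →L[ℝ] E) (w w' : C(I, E)) :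
    superposition L B w - superposition L B w' = superpositionSlope L B w w' (w - w') := by
  simp only [superposition, superpositionSlope, add_apply,
    ContinuousLinearMap.flip_apply, map_sub]
  abel

theorem contDiff_superposition (L : E →L[ℝ] E) (B : E →L[ℝ] E →L[ℝ] E) :
    ContDiff ℝ ∞ (superposition L B) := by
  unfold superposition
  fun_prop

theorem hasFDerivAt_superposition (L : E →L[ℝ] E) (B : E →L[ℝ] E →L[ℝ] E) (w : C(I, E)) :
    HasFDerivAt (superposition L B) (superpositionSlope L B w w) w := by
  have h1 := (pointwiseLin L).hasFDerivAt (x := w)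
  have h2 := (pointwiseBilin B).hasFDerivAt_of_bilinear (hasFDerivAt_id w) (hasFDerivAt_id w)
  refine (h1.add h2).congr_fderiv ?_
  ext v : 1
  simp [superpositionSlope, add_assoc, ContinuousLinearMap.precompL]

theorem norm_smul_superpositionSlope_le (L : E →L[ℝ] E) (B : E →L[ℝ] E →L[ℝ] E)
    (w w' : C(I, E)) (τ : ℝ) (v : C(I, E)) (s : I) :
    ‖(τ • superpositionSlope L B w w') v s‖
      ≤ |τ| * (‖L‖ + ‖B‖ * ‖w‖ + ‖B‖ * ‖w'‖) * ‖v s‖ := by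
  rw [smul_apply, ContinuousMap.smul_apply, norm_smul, Real.norm_eq_abs,
    mul_assoc, superpositionSlope_apply]
  refine mul_le_mul_of_nonneg_left ?_ (abs_nonneg τ)
  have h1 := L.le_opNorm (v s)
  have h2 := B.le_opNorm₂ (w s) (v s)
  have h3 := B.le_opNorm₂ (v s) (w' s)
  have h4 : ‖B‖ * ‖w s‖ * ‖v s‖ ≤ ‖B‖ * ‖w‖ * ‖v s‖ := by
    gcongr; exact w.norm_coe_le_norm s
  have h5 : ‖B‖ * ‖v s‖ * ‖w' s‖ ≤ ‖B‖ * ‖v s‖ * ‖w'‖ := by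
    gcongr; exact w'.norm_coe_le_norm s
  calc _ ≤ ‖L (v s)‖ + ‖B (w s) (v s)‖ + ‖B (v s) (w' s)‖ := norm_add₃_le
    _ ≤ _ := by linarith

variable [CompleteSpace E]

theorem isUnit_one_sub_superpositionSlope (L : E →L[ℝ] E) (B : E →L[ℝ] E →L[ℝ] E)
    (w w' : C(I, E)) (τ : ℝ) :
    IsUnit (1 - primitiveCLM E ∘L (τ • superpositionSlope L B w w')) :=
  isUnit_one_sub_volterra _ _ (by positivity) (norm_smul_superpositionSlope_le L B w w' τ)

/-- The integral equation of the flow of `w ↦ L w + B w w`, with time rescaled to `[0, 1]`. -/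
noncomputable def flowEquation (L : E →L[ℝ] E) (B : E →L[ℝ] E →L[ℝ] E) (a : ℝ → E)
    (p : (ℝ × ℝ) × C(I, E)) : C(I, E) :=
  p.2 - constCLM E (a p.1.1) - p.1.2 • primitiveCLM E (superposition L B p.2)

theorem flowEquation_unique {L : E →L[ℝ] E} {B : E →L[ℝ] E →L[ℝ] E} {a : ℝ → E} {P : ℝ × ℝ}
    {w w' : C(I, E)} (h : flowEquation L B a (P, w) = 0) (h' : flowEquation L B a (P, w') = 0) :
    w = w' := by
  have hd : (1 - primitiveCLM E ∘L (P.2 • superpositionSlope L B w w')) (w - w') = 0 := by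
    have hs : (1 - primitiveCLM E ∘L (P.2 • superpositionSlope L B w w')) (w - w')
        = (w - w') - P.2 • primitiveCLM E (superposition L B w - superposition L B w') := by
      rw [superposition_sub]
      exact congrArg (fun z => (w - w') - z) (map_smul (primitiveCLM E) P.2 _)
    rw [hs, map_sub, smul_sub, ← sub_self (0 : C(I, E))]
    nth_rw 1 [← h]
    rw [← h']
    simp only [flowEquation]
    abel
  obtain ⟨U, hU⟩ := isUnit_one_sub_superpositionSlope L B w w' P.2
  rw [← hU] at hd
  have := congrArg (fun z => (U⁻¹).val z) hd
  simp only [map_zero, ← mul_apply_eq_comp, Units.inv_mul,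
    one_apply_eq_self] at this
  exact sub_eq_zero.1 this

theorem flowEquation_of_solution {L : E →L[ℝ] E} {B : E →L[ℝ] E →L[ℝ] E} {a : ℝ → E}
    {x τ : ℝ} (hτ : 0 ≤ τ) {α : ℝ → E} (h0 : α 0 = a x)
    (hα : ∀ z, 0 ≤ z → HasDerivAt α (L (α z) + B (α z) (α z)) z) (w : C(I, E))
    (hw : ∀ s : I, w s = α (s * τ)) : flowEquation L B a ((x, τ), w) = 0 := by
  ext s
  simp only [flowEquation, ContinuousMap.sub_apply, ContinuousMap.smul_apply, constCLM_apply,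
    primitiveCLM_apply, ContinuousMap.zero_apply]
  have key : ∫ z in (0 : ℝ)..s, τ • superposition L B w (projIcc 0 1 zero_le_one z)
      = α (s * τ) - α (0 * τ) := by
    refine intervalIntegral.integral_eq_sub_of_hasDerivAt (f := fun z => α (z * τ)) ?_ ?_
    · intro z hz
      rw [uIcc_of_le s.2.1] at hz
      have h1 : z ∈ Icc (0 : ℝ) 1 := ⟨hz.1, hz.2.trans s.2.2⟩
      have := (hα (z * τ) (mul_nonneg hz.1 hτ)).scomp z ((hasDerivAt_id z).mul_const τ)
      rw [projIcc_of_mem _ h1]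
      simpa [superposition, pointwiseLin_apply, pointwiseBilin_apply, hw,
        Function.comp_def] using! this
    · exact (by fun_prop : Continuous fun z : ℝ =>
        τ • superposition L B w (projIcc 0 1 zero_le_one z)).intervalIntegrable _ _
  rw [intervalIntegral.integral_smul, zero_mul, h0] at key
  rw [key, hw]
  abel

theorem contDiffAt_flowEquation (L : E →L[ℝ] E) (B : E →L[ℝ] E →L[ℝ] E) {a : ℝ → E} {x τ : ℝ}
    (ha : ContDiffAt ℝ ∞ a x) (w : C(I, E)) :
    ContDiffAt ℝ ∞ (flowEquation L B a) ((x, τ), w) := by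
  have h1 : ContDiffAt ℝ ∞ (fun p : (ℝ × ℝ) × C(I, E) => a p.1.1) ((x, τ), w) :=
    ha.comp ((x, τ), w) (by fun_prop : ContDiffAt ℝ ∞ (fun p : (ℝ × ℝ) × C(I, E) => p.1.1) _)
  have h2 : ContDiffAt ℝ ∞ (fun p : (ℝ × ℝ) × C(I, E) => superposition L B p.2) ((x, τ), w) :=
    ((contDiff_superposition L B).comp contDiff_snd).contDiffAt
  unfold flowEquation
  fun_prop

theorem isInvertible_fderiv_flowEquation (L : E →L[ℝ] E) (B : E →L[ℝ] E →L[ℝ] E) {a : ℝ → E}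
    {x τ : ℝ} (ha : ContDiffAt ℝ ∞ a x) (w : C(I, E)) :
    (fderiv ℝ (flowEquation L B a) ((x, τ), w) ∘L .inr ℝ (ℝ × ℝ) C(I, E)).IsInvertible := by
  have h1 : HasFDerivAt (fun v => flowEquation L B a ((x, τ), v))
      (fderiv ℝ (flowEquation L B a) ((x, τ), w) ∘L .inr ℝ (ℝ × ℝ) C(I, E)) w :=
    ((contDiffAt_flowEquation L B ha w).differentiableAt (by simp)).hasFDerivAt.comp w
      (hasFDerivAt_prodMk_right (x, τ) w)
  have h2 : HasFDerivAt (fun v => flowEquation L B a ((x, τ), v))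
      (1 - primitiveCLM E ∘L (τ • superpositionSlope L B w w)) w := by
    have h3 := ((hasFDerivAt_id w).sub_const (constCLM E (a x))).sub
      (((primitiveCLM E).hasFDerivAt.comp w (hasFDerivAt_superposition L B w)).const_smul τ)
    refine h3.congr_fderiv ?_
    rw [ContinuousLinearMap.comp_smul]
    rfl
  rw [h1.unique h2]
  obtain ⟨U, hU⟩ := isUnit_one_sub_superpositionSlope L B w w τ
  exact ⟨ContinuousLinearEquiv.unitsEquiv ℝ _ U, by rw [← hU]; rfl⟩

/-- Solutions of an autonomous quadratic differential equation depend smoothly on time and on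
a parameter of the initial value, and the derivative in the parameter solves the
linearized equation. -/
theorem contDiffAt_quadratic_flow (L : E →L[ℝ] E) (B : E →L[ℝ] E →L[ℝ] E) {a : ℝ → E}
    {u : ℝ → ℝ → E} {x₀ τ₀ : ℝ} (hτ₀ : 0 < τ₀) (ha : ContDiffAt ℝ ∞ a x₀)
    (hu0 : ∀ᶠ x in 𝓝 x₀, u x 0 = a x)
    (hu : ∀ᶠ x in 𝓝 x₀, ∀ τ, 0 ≤ τ →
      HasDerivAt (u x) (L (u x τ) + B (u x τ) (u x τ)) τ) :
    ContDiffAt ℝ ∞ (fun P : ℝ × ℝ => u P.1 P.2) (x₀, τ₀) ∧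
    ∃ v : ℝ → E, v 0 = deriv a x₀ ∧
      (∀ s ∈ Icc (0 : ℝ) 1, HasDerivAt v (τ₀ • (L (v s) + B (u x₀ (s * τ₀)) (v s)
        + B (v s) (u x₀ (s * τ₀)))) s) ∧
      fderiv ℝ (fun P : ℝ × ℝ => u P.1 P.2) (x₀, τ₀) (1, 0) = v 1 := by
  have hex : ∀ᶠ P : ℝ × ℝ in 𝓝 (x₀, τ₀), ∃ w : C(I, E), (∀ s : I, w s = u P.1 (s * P.2)) ∧
      flowEquation L B a (P, w) = 0 := by
    have e1 : ∀ᶠ P : ℝ × ℝ in 𝓝 (x₀, τ₀), 0 < P.2 :=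
      continuousAt_snd.eventually_const_lt hτ₀
    have e2 := (continuousAt_fst (p := (x₀, τ₀))).eventually hu0
    have e3 := (continuousAt_fst (p := (x₀, τ₀))).eventually hu
    filter_upwards [e1, e2, e3] with P h1 h2 h3
    have hc : Continuous fun s : I => u P.1 (s * P.2) := by
      rw [continuous_iff_continuousAt]
      intro s
      exact ContinuousAt.comp (g := u P.1) (h3 _ (mul_nonneg s.2.1 h1.le)).continuousAt
        (by fun_prop)
    exact ⟨⟨_, hc⟩, fun s => rfl, flowEquation_of_solution h1.le h2 h3 _ fun s => rfl⟩
  obtain ⟨w₀, hw₀, hw₀'⟩ := hex.self_of_nhds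
  have hcd := contDiffAt_flowEquation L B (τ := τ₀) ha w₀
  have hinv := isInvertible_fderiv_flowEquation L B (τ := τ₀) ha w₀
  have hn : (∞ : WithTop ℕ∞) ≠ 0 := by simp
  set ψ := hcd.implicitFunction hn hinv
  have hψ : ContDiffAt ℝ ∞ ψ (x₀, τ₀) := hcd.contDiffAt_implicitFunction hn hinv
  have hψ0 : ψ (x₀, τ₀) = w₀ := hcd.implicitFunction_apply_self hn hinv
  have hψe : ∀ᶠ P in 𝓝 (x₀, τ₀), flowEquation L B a (P, ψ P) = 0 := by
    simpa only [hw₀'] using hcd.eventually_apply_implicitFunction hn hinv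
  have hueq : (fun P : ℝ × ℝ => u P.1 P.2) =ᶠ[𝓝 (x₀, τ₀)]
      fun P => ContinuousMap.evalCLM ℝ (1 : I) (ψ P) := by
    filter_upwards [hψe, hex] with P h1 ⟨w, hw, hw'⟩
    rw [flowEquation_unique h1 hw']
    simp [hw]
  have hψd : HasFDerivAt ψ (fderiv ℝ ψ (x₀, τ₀)) (x₀, τ₀) :=
    (hψ.differentiableAt (by simp)).hasFDerivAt
  have hevd := (ContinuousMap.evalCLM ℝ (M := E) (1 : I)).hasFDerivAt.comp (x₀, τ₀) hψd
  set V : C(I, E) := fderiv ℝ ψ (x₀, τ₀) (1, 0) with hVdef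
  have hV : V = constCLM E (deriv a x₀) + τ₀ • primitiveCLM E (superpositionSlope L B w₀ w₀ V) := by
    have hline : HasDerivAt (fun x : ℝ => (x, τ₀)) ((1 : ℝ), (0 : ℝ)) x₀ :=
      (hasDerivAt_id x₀).prodMk (hasDerivAt_const x₀ τ₀)
    have d1 : HasDerivAt (fun x => ψ (x, τ₀)) V x₀ :=
      hψd.comp_hasDerivAt x₀ hline
    have d2 : HasDerivAt (fun x => superposition L B (ψ (x, τ₀)))
        (superpositionSlope L B w₀ w₀ V) x₀ := by
      refine HasFDerivAt.comp_hasDerivAt x₀ (l := superposition L B) ?_ d1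
      rw [hψ0]
      exact hasFDerivAt_superposition L B w₀
    have d3 : HasDerivAt (fun x => constCLM E (a x)) (constCLM E (deriv a x₀)) x₀ :=
      (constCLM E).hasFDerivAt.comp_hasDerivAt x₀
        (ha.differentiableAt (by simp)).hasDerivAt
    have d4 := d3.add (((primitiveCLM E).hasFDerivAt.comp_hasDerivAt x₀ d2).const_smul τ₀)
    refine d1.unique (d4.congr_of_eventuallyEq ?_)
    have hc : ContinuousAt (fun x : ℝ => (x, τ₀)) x₀ := hline.continuousAt
    filter_upwards [hc.eventually hψe] with x hx
    have : ψ (x, τ₀) - constCLM E (a x) - τ₀ • primitiveCLM E (superposition L B (ψ (x, τ₀))) = 0 :=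
      hx
    rw [sub_sub, sub_eq_zero] at this
    exact this
  refine ⟨((ContinuousMap.evalCLM ℝ (M := E) (1 : I)).contDiff.contDiffAt.comp (x₀, τ₀)
    hψ).congr_of_eventuallyEq hueq, ?_⟩
  set g : ℝ → E := fun z => superpositionSlope L B w₀ w₀ V (projIcc 0 1 zero_le_one z) with hg
  have hgc : Continuous g := by fun_prop
  have hVs : ∀ s : I, V s = deriv a x₀ + τ₀ • ∫ z in (0 : ℝ)..s, g z := fun s => by
    conv_lhs => rw [hV]
    rfl
  refine ⟨fun s => deriv a x₀ + τ₀ • ∫ z in (0 : ℝ)..s, g z, by simp, fun s hs => ?_, ?_⟩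
  · have h1 := ((intervalIntegral.integral_hasDerivAt_right (hgc.intervalIntegrable 0 s)
      (hgc.stronglyMeasurableAtFilter _ _) hgc.continuousAt).const_smul τ₀).const_add
        (deriv a x₀)
    refine h1.congr_deriv ?_
    have h2 := hVs ⟨s, hs⟩
    have h3 := hw₀ ⟨s, hs⟩
    simp only at h2 h3
    beta_reduce
    rw [← h2, ← h3, hg]
    simp only [projIcc_of_mem _ hs]
    rfl
  · rw [hueq.fderiv_eq]
    have := hVs 1
    rw [show ((1 : I) : ℝ) = 1 from rfl] at this
    beta_reduce
    rw [← this]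
    have h4 : fderiv ℝ (fun P => ContinuousMap.evalCLM ℝ (1 : I) (ψ P)) (x₀, τ₀) = _ :=
      hevd.fderiv
    rw [h4]
    rfl

end SmoothDependence

section GlobalExistence

open scoped NNReal Topology

theorem HasDerivAt.fst_comp {E F : Type*} [NormedAddCommGroup E] [NormedSpace ℝ E]
    [NormedAddCommGroup F] [NormedSpace ℝ F] {f : ℝ → E × F} {f' : E × F} {τ : ℝ}
    (h : HasDerivAt f f' τ) : HasDerivAt (fun z => (f z).1) f'.1 τ :=
  (ContinuousLinearMap.fst ℝ E F).hasFDerivAt.comp_hasDerivAt τ h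

theorem HasDerivAt.snd_comp {E F : Type*} [NormedAddCommGroup E] [NormedSpace ℝ E]
    [NormedAddCommGroup F] [NormedSpace ℝ F] {f : ℝ → E × F} {f' : E × F} {τ : ℝ}
    (h : HasDerivAt f f' τ) : HasDerivAt (fun z => (f z).2) f'.2 τ :=
  (ContinuousLinearMap.snd ℝ E F).hasFDerivAt.comp_hasDerivAt τ h

/-- A bounded Lipschitz autonomous vector field has global integral curves. -/
theorem exists_forall_hasDerivAt_of_bounded_lipschitz {E : Type*} [NormedAddCommGroup E]
    [NormedSpace ℝ E] [CompleteSpace E] {G : E → E} {K M : ℝ≥0} (hK : LipschitzWith K G)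
    (hM : ∀ z, ‖G z‖ ≤ M) (p : E) :
    ∃ α : ℝ → E, α 0 = p ∧ ∀ τ, HasDerivAt α (G (α τ)) τ := by
  have hloc : ∀ a : ℝ, ∃ γ : ℝ → E, γ 0 = p ∧ ∀ τ ∈ Ioo (-a) a, HasDerivAt γ (G (γ τ)) τ := by
    intro a
    rcases le_or_gt a 0 with ha | ha
    · refine ⟨fun _ => p, rfl, fun τ hτ => ?_⟩
      exact absurd (hτ.1.trans hτ.2) (by linarith)
    have h0 : (0 : ℝ) ∈ Icc (-a) a := ⟨by linarith, ha.le⟩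
    have hPL : IsPicardLindelof (fun _ => G) (tmin := -a) (tmax := a) ⟨0, h0⟩ p
        (M * a.toNNReal) 0 M K := by
      refine ⟨fun _ _ => hK.lipschitzOnWith, fun _ _ => continuousOn_const,
        fun _ _ z _ => hM z, ?_⟩
      simp [ha.le]
    obtain ⟨γ, hγ0, hγ⟩ := hPL.exists_eq_forall_mem_Icc_hasDerivWithinAt₀
    exact ⟨γ, hγ0, fun τ hτ => (hγ τ (Ioo_subset_Icc_self hτ)).hasDerivAt
      (Icc_mem_nhds hτ.1 hτ.2)⟩
  choose γ hγ0 hγ using hloc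
  have hglue : ∀ a b : ℝ, 0 < a → a ≤ b → EqOn (γ a) (γ b) (Ioo (-a) a) := by
    intro a b ha hab
    refine ODE_solution_unique_of_mem_Ioo (v := fun _ => G) (s := fun _ => univ) (K := K)
      (fun _ _ => hK.lipschitzOnWith) (t₀ := 0) ⟨by linarith, ha⟩
      (fun τ hτ => ⟨hγ a τ hτ, mem_univ _⟩) (fun τ hτ => ⟨hγ b τ ?_, mem_univ _⟩)
      ((hγ0 a).trans (hγ0 b).symm)
    exact ⟨by linarith [hτ.1], hτ.2.trans_le hab⟩
  refine ⟨fun τ => γ (|τ| + 1) τ, hγ0 _, fun τ => ?_⟩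
  have hmem : τ ∈ Ioo (-(|τ| + 1)) (|τ| + 1) := by
    rw [mem_Ioo, ← abs_lt]; linarith
  refine (hγ (|τ| + 1) τ hmem).congr_of_eventuallyEq ?_
  filter_upwards [Ioo_mem_nhds hmem.1 hmem.2] with z hz
  rcases le_total (|z| + 1) (|τ| + 1) with h | h
  · exact hglue _ _ (by positivity) h (by rw [mem_Ioo, ← abs_lt]; linarith)
  · exact (hglue _ _ (by positivity) h hz).symm

/-- A differentiable function that is nonnegative at `0` and whose derivative is nonnegative
wherever the function is negative stays nonnegative. -/
theorem nonneg_of_hasDerivAt_of_neg_imp_Icc {f f' : ℝ → ℝ} {τ : ℝ} (hτ : 0 ≤ τ) (h0 : 0 ≤ f 0)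
    (hf : ∀ z ∈ Icc 0 τ, HasDerivAt f (f' z) z) (hf' : ∀ z ∈ Icc 0 τ, f z < 0 → 0 ≤ f' z) :
    0 ≤ f τ := by
  have key : ∀ ε : ℝ, 0 < ε → -f τ ≤ ε * (1 + τ) := by
    intro ε hε
    refine image_le_of_deriv_right_lt_deriv_boundary (a := 0) (b := τ) (f := fun z => -f z)
      (f' := fun z => -f' z) (B := fun z => ε * (1 + z)) (B' := fun _ => ε) ?_ ?_ ?_ ?_ ?_
      ⟨hτ, le_rfl⟩
    · exact fun z hz => (hf z hz).neg.continuousAt.continuousWithinAt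
    · exact fun z hz => (hf z (Ico_subset_Icc_self hz)).neg.hasDerivWithinAt
    · simp only [add_zero, mul_one]; linarith
    · intro z
      simpa using ((hasDerivAt_id z).const_add 1).const_mul ε
    · intro z hz hzeq
      have hz0 := hz.1
      have : f z < 0 := by
        have : 0 < ε * (1 + z) := by positivity
        linarith
      linarith [hf' z (Ico_subset_Icc_self hz) this]
  by_contra! hneg
  have h1 := key (-f τ / (2 * (1 + τ))) (by apply div_pos <;> linarith)
  have h2 : -f τ / (2 * (1 + τ)) * (1 + τ) = -f τ / 2 := by field_simp
  linarith

theorem nonneg_of_hasDerivAt_of_neg_imp {f f' : ℝ → ℝ} (h0 : 0 ≤ f 0)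
    (hf : ∀ τ, 0 ≤ τ → HasDerivAt f (f' τ) τ) (hf' : ∀ τ, 0 ≤ τ → f τ < 0 → 0 ≤ f' τ)
    {τ : ℝ} (hτ : 0 ≤ τ) : 0 ≤ f τ :=
  nonneg_of_hasDerivAt_of_neg_imp_Icc hτ h0 (fun z hz => hf z hz.1) (fun z hz => hf' z hz.1)

theorem nonneg_of_hasDerivAt_nonneg {f f' : ℝ → ℝ} (h0 : 0 ≤ f 0)
    (hf : ∀ τ, 0 ≤ τ → HasDerivAt f (f' τ) τ) (hf' : ∀ τ, 0 ≤ τ → 0 ≤ f' τ)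
    {τ : ℝ} (hτ : 0 ≤ τ) : 0 ≤ f τ :=
  nonneg_of_hasDerivAt_of_neg_imp h0 hf (fun τ h _ => hf' τ h) hτ

end GlobalExistence

section Characteristics

/-- The truncation of a real number to the unit interval. -/
noncomputable def unitClamp (y : ℝ) : ℝ := max 0 (min y 1)

theorem unitClamp_nonneg (y : ℝ) : 0 ≤ unitClamp y := le_max_left _ _

theorem unitClamp_le_one (y : ℝ) : unitClamp y ≤ 1 := max_le zero_le_one (min_le_right _ _)

theorem unitClamp_of_mem {y : ℝ} (h0 : 0 ≤ y) (h1 : y ≤ 1) : unitClamp y = y := by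
  rw [unitClamp, min_eq_left h1, max_eq_right h0]

theorem unitClamp_of_neg {y : ℝ} (h0 : y < 0) : unitClamp y = 0 := by
  rw [unitClamp, max_eq_left ((min_le_left _ _).trans h0.le)]

theorem unitClamp_mono {y z : ℝ} (h : y ≤ z) : unitClamp y ≤ unitClamp z :=
  max_le_max le_rfl (min_le_min h le_rfl)

theorem abs_unitClamp_sub_le (y z : ℝ) : |unitClamp y - unitClamp z| ≤ |y - z| := by
  unfold unitClamp
  grind

/-- The truncated characteristic vector field, with the space and time variables normalized by
the initial position. -/
noncomputable def clampedField (z : ℝ × ℝ × ℝ × ℝ) : ℝ × ℝ × ℝ × ℝ :=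
  (-(unitClamp z.1 - unitClamp z.2.1) / 2, -(unitClamp z.2.1 * (1 - unitClamp z.1)),
    -(unitClamp z.2.2.1 * (unitClamp z.1 + 1 / 2)), unitClamp z.2.2.1)

theorem norm_clampedField_le (z : ℝ × ℝ × ℝ × ℝ) : ‖clampedField z‖ ≤ (2 : NNReal) := by
  have h1 := unitClamp_nonneg z.1
  have h2 := unitClamp_nonneg z.2.1
  have h3 := unitClamp_nonneg z.2.2.1
  have h4 := unitClamp_le_one z.1
  have h5 := unitClamp_le_one z.2.1
  have h6 := unitClamp_le_one z.2.2.1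
  simp only [clampedField, Prod.norm_def, Real.norm_eq_abs, NNReal.coe_ofNat, max_le_iff, abs_le]
  refine ⟨⟨by linarith, by linarith⟩, ⟨?_, ?_⟩, ⟨?_, ?_⟩, ⟨by linarith, by linarith⟩⟩ <;>
    nlinarith

theorem lipschitzWith_clampedField : LipschitzWith 4 clampedField := by
  refine LipschitzWith.of_dist_le_mul fun z w => ?_
  have d1 : |unitClamp z.1 - unitClamp w.1| ≤ dist z w :=
    (abs_unitClamp_sub_le _ _).trans (le_max_left _ _)
  have d2 : |unitClamp z.2.1 - unitClamp w.2.1| ≤ dist z w :=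
    (abs_unitClamp_sub_le _ _).trans ((le_max_left _ _).trans (le_max_right _ _))
  have d3 : |unitClamp z.2.2.1 - unitClamp w.2.2.1| ≤ dist z w :=
    (abs_unitClamp_sub_le _ _).trans
      ((le_max_left _ _).trans ((le_max_right _ _).trans (le_max_right _ _)))
  set δ := dist z w
  have a1 := unitClamp_nonneg z.1
  have a4 := unitClamp_le_one z.1
  have b2 := unitClamp_nonneg w.2.1
  have b3 := unitClamp_nonneg w.2.2.1
  have b5 := unitClamp_le_one w.2.1
  have b6 := unitClamp_le_one w.2.2.1
  rw [Prod.dist_eq, Prod.dist_eq, Prod.dist_eq]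
  simp only [clampedField, Real.dist_eq, NNReal.coe_ofNat, max_le_iff]
  generalize unitClamp z.1 = p1 at *
  generalize unitClamp z.2.1 = p2 at *
  generalize unitClamp z.2.2.1 = p3 at *
  generalize unitClamp w.1 = q1 at *
  generalize unitClamp w.2.1 = q2 at *
  generalize unitClamp w.2.2.1 = q3 at *
  have hδ : 0 ≤ δ := (abs_nonneg _).trans d1
  refine ⟨?_, ?_, ?_, by linarith⟩
  · rw [abs_le] at *
    constructor <;> linarith
  · have : -(p2 * (1 - p1)) - -(q2 * (1 - q1)) = -((p2 - q2) * (1 - p1)) + q2 * (p1 - q1) := by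
      ring
    rw [this]
    refine (abs_add_le _ _).trans ?_
    rw [abs_neg, abs_mul, abs_mul, abs_of_nonneg (by linarith : 0 ≤ 1 - p1), abs_of_nonneg b2]
    nlinarith [abs_nonneg (p2 - q2), abs_nonneg (p1 - q1)]
  · have : -(p3 * (p1 + 1 / 2)) - -(q3 * (q1 + 1 / 2))
        = -((p3 - q3) * (p1 + 1 / 2)) + -(q3 * (p1 - q1)) := by
      ring
    rw [this]
    refine (abs_add_le _ _).trans ?_
    rw [abs_neg, abs_neg, abs_mul, abs_mul, abs_of_nonneg (by linarith : 0 ≤ p1 + 1 / 2),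
      abs_of_nonneg b3]
    nlinarith [abs_nonneg (p3 - q3), abs_nonneg (p1 - q1)]

/-- A characteristic curve in logarithmic time: `e = m - ∂ₓF` and `(e + r) / 2 = m - F / x` along
the curve `τ ↦ (x, t)`. -/
structure IsCharacteristic (m : ℝ) (e r x t : ℝ → ℝ) : Prop where
  hasDerivAt_e : ∀ τ, 0 ≤ τ → HasDerivAt e (-(e τ - r τ) / 2) τ
  hasDerivAt_r : ∀ τ, 0 ≤ τ → HasDerivAt r (-(r τ * (1 - e τ))) τ
  hasDerivAt_x : ∀ τ, 0 ≤ τ → HasDerivAt x (-(x τ * (e τ + 1 / 2))) τ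
  hasDerivAt_t : ∀ τ, 0 ≤ τ → HasDerivAt t (x τ) τ
  r_nonneg : ∀ τ, 0 ≤ τ → 0 ≤ r τ
  r_le_e : ∀ τ, 0 ≤ τ → r τ ≤ e τ
  e_le : ∀ τ, 0 ≤ τ → e τ ≤ m
  x_pos : ∀ τ, 0 ≤ τ → 0 < x τ
  t_zero : t 0 = 0

theorem exists_isCharacteristic {m e₀ r₀ x₀ : ℝ} (hm : m ≤ 1) (hr : 0 ≤ r₀) (hre : r₀ ≤ e₀)
    (hem : e₀ ≤ m) (hx : 0 < x₀) :
    ∃ e r x t : ℝ → ℝ, e 0 = e₀ ∧ r 0 = r₀ ∧ x 0 = x₀ ∧ IsCharacteristic m e r x t := by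
  obtain ⟨α, hα0, hα⟩ := exists_forall_hasDerivAt_of_bounded_lipschitz
    lipschitzWith_clampedField norm_clampedField_le ((e₀, r₀, 1, 0) : ℝ × ℝ × ℝ × ℝ)
  have de : ∀ τ, HasDerivAt (fun τ => (α τ).1)
      (-(unitClamp (α τ).1 - unitClamp (α τ).2.1) / 2) τ := fun τ =>
    (hα τ).fst_comp
  have d2 : ∀ τ, HasDerivAt (fun τ => (α τ).2) (clampedField (α τ)).2 τ := fun τ =>
    (hα τ).snd_comp
  have dr : ∀ τ, HasDerivAt (fun τ => (α τ).2.1)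
      (-(unitClamp (α τ).2.1 * (1 - unitClamp (α τ).1))) τ := fun τ =>
    (d2 τ).fst_comp
  have d3 : ∀ τ, HasDerivAt (fun τ => (α τ).2.2) (clampedField (α τ)).2.2 τ := fun τ =>
    (d2 τ).snd_comp
  have dx : ∀ τ, HasDerivAt (fun τ => (α τ).2.2.1)
      (-(unitClamp (α τ).2.2.1 * (unitClamp (α τ).1 + 1 / 2))) τ := fun τ =>
    (d3 τ).fst_comp
  have dt : ∀ τ, HasDerivAt (fun τ => (α τ).2.2.2) (unitClamp (α τ).2.2.1) τ := fun τ =>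
    (d3 τ).snd_comp
  have he0 : (α 0).1 = e₀ := by rw [hα0]
  have hr0 : (α 0).2.1 = r₀ := by rw [hα0]
  have hx0 : (α 0).2.2.1 = 1 := by rw [hα0]
  have ht0 : (α 0).2.2.2 = 0 := by rw [hα0]
  generalize hE : (fun τ => (α τ).1) = e at de
  generalize hR : (fun τ => (α τ).2.1) = r at dr
  generalize hX : (fun τ => (α τ).2.2.1) = ξ at dx
  generalize hT : (fun τ => (α τ).2.2.2) = θ at dt
  have hE' : ∀ τ, (α τ).1 = e τ := fun τ => congrFun hE τ
  have hR' : ∀ τ, (α τ).2.1 = r τ := fun τ => congrFun hR τ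
  have hX' : ∀ τ, (α τ).2.2.1 = ξ τ := fun τ => congrFun hX τ
  have hT' : ∀ τ, (α τ).2.2.2 = θ τ := fun τ => congrFun hT τ
  simp only [hE', hR', hX', hT'] at de dr dx dt he0 hr0 hx0 ht0
  have i1 : ∀ τ, 0 ≤ τ → 0 ≤ r τ := fun τ hτ =>
    nonneg_of_hasDerivAt_of_neg_imp (hr0 ▸ hr) (fun τ _ => dr τ)
      (fun τ _ h => by rw [unitClamp_of_neg h]; simp) hτ
  have i2 : ∀ τ, 0 ≤ τ → 0 ≤ e τ - r τ := fun τ hτ =>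
    nonneg_of_hasDerivAt_of_neg_imp (f := fun τ => e τ - r τ)
      (by rw [he0, hr0]; linarith) (fun τ _ => (de τ).sub (dr τ))
      (fun τ _ h => by
        have h1 := unitClamp_mono (sub_neg.1 h).le
        have h2 := mul_nonneg (unitClamp_nonneg (r τ)) (sub_nonneg.2 (unitClamp_le_one (e τ)))
        linarith) hτ
  have i3 : ∀ τ, 0 ≤ τ → 0 ≤ m - e τ := fun τ hτ =>
    nonneg_of_hasDerivAt_nonneg (f := fun τ => m - e τ)
      (by rw [he0]; linarith) (fun τ _ => (de τ).const_sub m)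
      (fun τ h => by linarith [unitClamp_mono (sub_nonneg.1 (i2 τ h))]) hτ
  have i4 : ∀ τ, 0 ≤ τ → 0 ≤ ξ τ := fun τ hτ =>
    nonneg_of_hasDerivAt_of_neg_imp (by rw [hx0]; norm_num) (fun τ _ => dx τ)
      (fun τ _ h => by rw [unitClamp_of_neg h]; simp) hτ
  have i5 : ∀ τ, 0 ≤ τ → 0 ≤ 1 - ξ τ := fun τ hτ =>
    nonneg_of_hasDerivAt_nonneg (f := fun τ => 1 - ξ τ)
      (by rw [hx0]; norm_num) (fun τ _ => (dx τ).const_sub 1)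
      (fun τ h => by
        have := mul_nonneg (unitClamp_nonneg (ξ τ))
          (by linarith [unitClamp_nonneg (e τ)] : 0 ≤ unitClamp (e τ) + 1 / 2)
        linarith) hτ
  have ce : ∀ τ, 0 ≤ τ → unitClamp (e τ) = e τ := fun τ hτ =>
    unitClamp_of_mem (by linarith [i1 τ hτ, i2 τ hτ]) (by linarith [i3 τ hτ])
  have cr : ∀ τ, 0 ≤ τ → unitClamp (r τ) = r τ := fun τ hτ =>
    unitClamp_of_mem (i1 τ hτ) (by linarith [i3 τ hτ, i2 τ hτ])
  have cx : ∀ τ, 0 ≤ τ → unitClamp (ξ τ) = ξ τ := fun τ hτ =>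
    unitClamp_of_mem (i4 τ hτ) (by linarith [i5 τ hτ])
  have i6 : ∀ τ, 0 ≤ τ → 0 ≤ ξ τ * Real.exp (3 / 2 * τ) - 1 := fun τ hτ =>
    nonneg_of_hasDerivAt_nonneg (f := fun τ => ξ τ * Real.exp (3 / 2 * τ) - 1)
      (by simp [hx0])
      (fun τ _ => ((dx τ).mul (((hasDerivAt_id τ).const_mul (3 / 2)).exp)).sub_const 1)
      (fun τ h => by
        rw [ce τ h, cx τ h]
        have : -(ξ τ * (e τ + 1 / 2)) * Real.exp (3 / 2 * τ)
            + ξ τ * (Real.exp (3 / 2 * τ) * (3 / 2 * 1))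
            = ξ τ * (1 - e τ) * Real.exp (3 / 2 * τ) := by ring
        simp only [id]
        rw [this]
        exact mul_nonneg (mul_nonneg (i4 τ h) (by linarith [i3 τ h])) (Real.exp_pos _).le) hτ
  refine ⟨e, r, fun τ => x₀ * ξ τ, fun τ => x₀ * θ τ, he0, hr0, by simp [hx0], ?_⟩
  refine ⟨fun τ h => ?_, fun τ h => ?_, fun τ h => ?_, fun τ h => ?_, i1,
    fun τ h => by linarith [i2 τ h], fun τ h => by linarith [i3 τ h], fun τ h => ?_,
    by simp [ht0]⟩
  · have := de τ
    rwa [ce τ h, cr τ h] at this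
  · have := dr τ
    rwa [ce τ h, cr τ h] at this
  · have := (dx τ).const_mul x₀
    rw [ce τ h, cx τ h] at this
    exact this.congr_deriv (by ring)
  · have := (dt τ).const_mul x₀
    rwa [cx τ h] at this
  · have h1 := i6 τ h
    refine mul_pos hx ((i4 τ h).lt_of_ne fun h0 => ?_)
    rw [← h0] at h1
    linarith

end Characteristics

section BernsteinData

open scoped Topology ContDiff

theorem one_add_mul_exp_neg_le_one (u : ℝ) : (1 + u) * Real.exp (-u) ≤ 1 := by
  have h := Real.add_one_le_exp u
  rw [Real.exp_neg]
  rw [← div_eq_mul_inv, div_le_one (Real.exp_pos u)]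
  linarith

theorem two_mul_one_sub_exp_neg_le {u : ℝ} (hu : 0 ≤ u) :
    2 * (1 - Real.exp (-u)) ≤ u + u * Real.exp (-u) := by
  have h : ∀ y : ℝ, HasDerivAt (fun y => Real.exp (-y)) (-Real.exp (-y)) y := fun y => by
    simpa using (hasDerivAt_neg y).exp
  have := nonneg_of_hasDerivAt_nonneg
    (f := fun y => y + y * Real.exp (-y) - 2 * (1 - Real.exp (-y))) (by simp)
    (fun y _ => ((hasDerivAt_id y).add ((hasDerivAt_id y).mul (h y))).sub
      (((h y).const_sub 1).const_mul 2))
    (fun y _ => by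
      simp only [id]
      linarith [one_add_mul_exp_neg_le_one y]) hu
  linarith

theorem sub_one_sub_exp_neg_le {u : ℝ} (hu : 0 ≤ u) : u - (1 - Real.exp (-u)) ≤ u ^ 2 / 2 := by
  have h : ∀ y : ℝ, HasDerivAt (fun y => Real.exp (-y)) (-Real.exp (-y)) y := fun y => by
    simpa using (hasDerivAt_neg y).exp
  have := nonneg_of_hasDerivAt_nonneg
    (f := fun y => y ^ 2 / 2 - (y - (1 - Real.exp (-y)))) (by simp)
    (fun y _ => (((hasDerivAt_id y).pow 2).div_const 2).sub
      ((hasDerivAt_id y).sub ((h y).const_sub 1)))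
    (fun y _ => by
      have := Real.add_one_le_exp (-y)
      simp
      linarith) hu
  linarith

/-- Smooth initial data `g` on `(0, ∞)` for which the characteristics of the
Hamilton-Jacobi equation fill the quadrant without crossing. -/
structure AdmissibleData (m C : ℝ) (g : ℝ → ℝ) : Prop where
  contDiffAt : ∀ x, 0 < x → ContDiffAt ℝ ∞ g x
  deriv_nonneg : ∀ x, 0 < x → 0 ≤ deriv g x
  two_mul_le : ∀ x, 0 < x → 2 * g x ≤ x * (m + deriv g x)
  mul_deriv_le : ∀ x, 0 < x → x * deriv g x ≤ g x
  deriv_sub_le : ∀ x, 0 < x → deriv g x - x * deriv (deriv g) x ≤ m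
  mul_sub_le : ∀ x, 0 < x → m * x - g x ≤ C * x ^ 2 / 2
  le_const : ∀ x, 0 < x → g x ≤ C

theorem admissibleData_bernstein {m C : ℝ} (hC : 0 < C) {μ : Measure ℝ}
    (hμ_int₁ : IntegrableOn (fun s => s) (Ioi 0) μ)
    (hμ_m : (∫ s in Ioi (0 : ℝ), s ∂μ) = m)
    (hμ_zeroth : μ (Ioi 0) ≤ ENNReal.ofReal C)
    (hμ_int₂ : IntegrableOn (fun s => s ^ 2) (Ioi 0) μ)
    (hμ_second : (∫ s in Ioi (0 : ℝ), s ^ 2 ∂μ) ≤ C)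
    {g : ℝ → ℝ}
    (hg : ∀ x : ℝ, 0 ≤ x → g x = ∫ s in Ioi (0 : ℝ), (1 - Real.exp (-(s * x))) ∂μ) :
    AdmissibleData m C g := by
  have hpos : ∀ᵐ s ∂(μ.restrict (Ioi 0)), 0 < s := ae_restrict_mem measurableSet_Ioi
  have hfin : IsFiniteMeasure (μ.restrict (Ioi 0)) :=
    ⟨by rw [Measure.restrict_apply_univ]; exact hμ_zeroth.trans_lt ENNReal.ofReal_lt_top⟩
  have hmass : (μ.restrict (Ioi 0)).real univ ≤ C := by
    rw [measureReal_def, Measure.restrict_apply_univ]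
    exact ENNReal.toReal_le_of_le_ofReal hC.le hμ_zeroth
  rw [IntegrableOn] at hμ_int₁ hμ_int₂
  generalize μ.restrict (Ioi 0) = ν at *
  have hint0 : ∀ x : ℝ, 0 ≤ x → Integrable (fun s => Real.exp (-(s * x))) ν := by
    intro x hx
    refine Integrable.mono' (integrable_const 1) (by fun_prop) ?_
    filter_upwards [hpos] with s hs
    rw [Real.norm_eq_abs, Real.abs_exp, Real.exp_le_one_iff]
    have := mul_nonneg hs.le hx
    linarith
  have hset : ∀ x : ℝ, 0 < x → -x ∈ interior (ProbabilityTheory.integrableExpSet id ν) := by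
    intro x hx
    rw [mem_interior_iff_mem_nhds]
    filter_upwards [Iio_mem_nhds (neg_lt_zero.2 hx)] with y hy
    have := hint0 (-y) (by linarith [mem_Iio.1 hy])
    simpa [ProbabilityTheory.integrableExpSet, mul_comm] using this
  have hintn : ∀ x : ℝ, 0 < x → ∀ n : ℕ, Integrable (fun s => s ^ n * Real.exp (-(s * x))) ν := by
    intro x hx n
    have := ProbabilityTheory.integrable_pow_mul_exp_of_mem_interior_integrableExpSet (hset x hx) n
    simpa [mul_comm] using this
  have hdn : ∀ x : ℝ, 0 < x → ∀ n : ℕ, HasDerivAt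
      (fun x => ∫ s, s ^ n * Real.exp (-(s * x)) ∂ν)
      (-∫ s, s ^ (n + 1) * Real.exp (-(s * x)) ∂ν) x := by
    intro x hx n
    have h1 := (ProbabilityTheory.hasDerivAt_integral_pow_mul_exp_real (hset x hx) n).scomp x
      (hasDerivAt_neg x)
    simpa [Function.comp_def, mul_comm] using! h1
  have hgeq : ∀ x : ℝ, 0 ≤ x → g x = ν.real univ - ∫ s, Real.exp (-(s * x)) ∂ν := by
    intro x hx
    rw [hg x hx, integral_sub (integrable_const 1) (hint0 x hx)]
    simp
  have hgev : ∀ x : ℝ, 0 < x →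
      g =ᶠ[𝓝 x] fun x => ν.real univ - ∫ s, Real.exp (-(s * x)) ∂ν := fun x hx => by
    filter_upwards [Ioi_mem_nhds hx] with y hy using hgeq y (mem_Ioi.1 hy).le
  have hg' : ∀ x : ℝ, 0 < x → deriv g x = ∫ s, s * Real.exp (-(s * x)) ∂ν := by
    intro x hx
    have h := (hdn x hx 0).const_sub (ν.real univ)
    simp only [pow_zero, one_mul, zero_add, pow_one, neg_neg] at h
    rw [(hgev x hx).deriv_eq, h.deriv]
  have hg'' : ∀ x : ℝ, 0 < x → deriv (deriv g) x = -∫ s, s ^ 2 * Real.exp (-(s * x)) ∂ν := by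
    intro x hx
    have h := hdn x hx 1
    simp only [pow_one, one_add_one_eq_two] at h
    rw [← h.deriv]
    refine EventuallyEq.deriv_eq ?_
    filter_upwards [Ioi_mem_nhds hx] with y hy using hg' y hy
  have i1 : ∀ x : ℝ, 0 < x → Integrable (fun s => s * Real.exp (-(s * x))) ν := fun x hx => by
    simpa using hintn x hx 1
  have ig : ∀ x : ℝ, 0 < x → Integrable (fun s => 1 - Real.exp (-(s * x))) ν := fun x hx =>
    (integrable_const 1).sub (hint0 x hx.le)
  refine ⟨fun x hx => ?_, fun x hx => ?_, fun x hx => ?_, fun x hx => ?_, fun x hx => ?_,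
    fun x hx => ?_, fun x hx => ?_⟩
  · refine ContDiffAt.congr_of_eventuallyEq (f := fun x => ν.real univ -
      ProbabilityTheory.mgf id ν (-x)) ?_ ?_
    · have h := (ProbabilityTheory.analyticAt_mgf (hset x hx)).contDiffAt (n := ∞)
      exact contDiffAt_const.sub (ContDiffAt.comp (g := ProbabilityTheory.mgf id ν) x h
        contDiffAt_id.neg)
    · filter_upwards [hgev x hx] with y hy
      rw [hy]
      simp [ProbabilityTheory.mgf, mul_comm]
  · rw [hg' x hx]
    refine integral_nonneg_of_ae ?_
    filter_upwards [hpos] with s hs using (mul_pos hs (Real.exp_pos _)).le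
  · rw [hg x hx.le, hg' x hx, ← hμ_m, ← integral_add hμ_int₁ (i1 x hx), ← integral_const_mul,
      ← integral_const_mul]
    refine integral_mono_ae ((ig x hx).const_mul 2) ((hμ_int₁.add (i1 x hx)).const_mul x) ?_
    filter_upwards [hpos] with s hs
    have := two_mul_one_sub_exp_neg_le (mul_pos hs hx).le
    linarith
  · rw [hg x hx.le, hg' x hx, ← integral_const_mul]
    refine integral_mono_ae ((i1 x hx).const_mul x) (ig x hx) ?_
    filter_upwards [hpos] with s hs
    have := one_add_mul_exp_neg_le_one (s * x)
    linarith
  · rw [hg' x hx, hg'' x hx, ← hμ_m, mul_neg, sub_neg_eq_add, ← integral_const_mul,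
      ← integral_add (i1 x hx) ((hintn x hx 2).const_mul x)]
    refine integral_mono_ae ((i1 x hx).add ((hintn x hx 2).const_mul x)) hμ_int₁ ?_
    filter_upwards [hpos] with s hs
    have := mul_le_mul_of_nonneg_left (one_add_mul_exp_neg_le_one (s * x)) hs.le
    linarith
  · have h1 : m * x - g x = ∫ s, (s * x - (1 - Real.exp (-(s * x)))) ∂ν := by
      rw [integral_sub (hμ_int₁.mul_const x) (ig x hx), integral_mul_const, hμ_m, hg x hx.le]
    have h2 : ∫ s, (s * x - (1 - Real.exp (-(s * x)))) ∂ν ≤ ∫ s, s ^ 2 * (x ^ 2 / 2) ∂ν := by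
      refine integral_mono_ae ((hμ_int₁.mul_const x).sub (ig x hx)) (hμ_int₂.mul_const _) ?_
      filter_upwards [hpos] with s hs
      have := sub_one_sub_exp_neg_le (mul_pos hs hx).le
      linarith
    rw [integral_mul_const] at h2
    have h3 := mul_le_mul_of_nonneg_right hμ_second (by positivity : 0 ≤ x ^ 2 / 2)
    linarith
  · rw [hgeq x hx.le]
    have : 0 ≤ ∫ s, Real.exp (-(s * x)) ∂ν := integral_nonneg fun s => (Real.exp_pos _).le
    linarith

end BernsteinData

section CharacteristicEstimates

variable {m C : ℝ} {e r x t : ℝ → ℝ} {τ : ℝ}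

namespace IsCharacteristic

theorem e_nonneg (h : IsCharacteristic m e r x t) (hτ : 0 ≤ τ) : 0 ≤ e τ :=
  (h.r_nonneg τ hτ).trans (h.r_le_e τ hτ)

theorem t_nonneg (h : IsCharacteristic m e r x t) (hτ : 0 ≤ τ) : 0 ≤ t τ :=
  nonneg_of_hasDerivAt_nonneg h.t_zero.ge h.hasDerivAt_t (fun z hz => (h.x_pos z hz).le) hτ

theorem t_le (h : IsCharacteristic m e r x t) (hτ : 0 ≤ τ) : t τ ≤ 2 * (x 0 - x τ) := by
  have := nonneg_of_hasDerivAt_nonneg (f := fun z => 2 * (x 0 - x z) - t z)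
    (by simp [h.t_zero])
    (fun z hz => (((h.hasDerivAt_x z hz).const_sub (x 0)).const_mul 2).sub (h.hasDerivAt_t z hz))
    (fun z hz => by nlinarith [mul_nonneg (h.x_pos z hz).le (h.e_nonneg hz)]) hτ
  linarith

theorem sub_le (h : IsCharacteristic m e r x t) (hτ : 0 ≤ τ) :
    x 0 - x τ ≤ (m + 1 / 2) * t τ := by
  have := nonneg_of_hasDerivAt_nonneg (f := fun z => (m + 1 / 2) * t z - (x 0 - x z))
    (by simp [h.t_zero])
    (fun z hz => ((h.hasDerivAt_t z hz).const_mul (m + 1 / 2)).sub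
      ((h.hasDerivAt_x z hz).const_sub (x 0)))
    (fun z hz => by nlinarith [mul_nonneg (h.x_pos z hz).le (sub_nonneg.2 (h.e_le z hz))]) hτ
  linarith

theorem x_le (h : IsCharacteristic m e r x t) (hτ : 0 ≤ τ) : x τ ≤ x 0 := by
  linarith [h.t_le hτ, h.t_nonneg hτ]

theorem x_mul_le (h : IsCharacteristic m e r x t) (hτ : 0 ≤ τ) :
    x τ * (1 + τ / 2) ≤ x 0 := by
  have := nonneg_of_hasDerivAt_nonneg (f := fun z => x 0 - x z * (1 + z / 2))
    (by simp)
    (fun z hz => (((h.hasDerivAt_x z hz).mul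
      (((hasDerivAt_id z).div_const 2).const_add 1)).const_sub (x 0)))
    (fun z hz => by
      have h1 := h.x_pos z hz
      have h2 := h.e_nonneg hz
      simp only [id]
      have h3 : 0 ≤ x z * (e z * (1 + z / 2) + z / 4) := by positivity
      linarith) hτ
  linarith

theorem strictAntiOn (h : IsCharacteristic m e r x t) : StrictAntiOn x (Ici 0) := by
  refine strictAntiOn_of_deriv_neg (convex_Ici 0)
    (fun z hz => (h.hasDerivAt_x z hz).continuousAt.continuousWithinAt) fun z hz => ?_
  rw [interior_Ici] at hz
  have hz' := (mem_Ioi.1 hz).le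
  rw [(h.hasDerivAt_x z hz').deriv]
  have := mul_pos (h.x_pos z hz') (by linarith [h.e_nonneg hz'] : 0 < e z + 1 / 2)
  linarith

theorem exists_x_eq (h : IsCharacteristic m e r x t) {x₁ : ℝ} (h0 : 0 < x₁) (h1 : x₁ < x 0) :
    ∃ τ, 0 < τ ∧ x τ = x₁ := by
  have hb : 0 ≤ 2 * x 0 / x₁ := by
    have := h0.trans h1
    positivity
  have h2 : x (2 * x 0 / x₁) ≤ x₁ := by
    have h3 := h.x_mul_le hb
    have h4 := h.x_pos _ hb
    have h5 : 2 * x 0 / x₁ / 2 = x 0 / x₁ := by ring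
    rw [h5] at h3
    have h6 : x (2 * x 0 / x₁) * (x 0 / x₁) ≤ x 0 := by nlinarith
    rw [← mul_div_assoc, div_le_iff₀ h0, mul_comm] at h6
    exact le_of_mul_le_mul_left h6 (h0.trans h1)
  obtain ⟨τ, hτ, hxτ⟩ := intermediate_value_Icc' hb (fun z hz =>
    (h.hasDerivAt_x z hz.1).continuousAt.continuousWithinAt) ⟨h2, h1.le⟩
  refine ⟨τ, hτ.1.lt_of_ne fun h7 => ?_, hxτ⟩
  rw [← h7] at hxτ
  exact h1.ne hxτ.symm

theorem e_le_mul (h : IsCharacteristic m e r x t) (hm : m < 1 / 2) (hC : 0 < C)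
    (h0 : e 0 + r 0 ≤ C * x 0) (hτ : 0 ≤ τ) : e τ ≤ C * Real.exp 4 * x τ := by
  have key := nonneg_of_hasDerivAt_of_neg_imp (τ := τ)
    (f := fun z => C * Real.exp 4 * x z - (e z + r z) * Real.exp (4 * (e z + r z))) ?_
    (fun z hz => ((h.hasDerivAt_x z hz).const_mul (C * Real.exp 4)).sub
      (((h.hasDerivAt_e z hz).add (h.hasDerivAt_r z hz)).mul
        ((((h.hasDerivAt_e z hz).add (h.hasDerivAt_r z hz)).const_mul 4).exp))) ?_ hτ
  · have h1 : 1 ≤ Real.exp (4 * (e τ + r τ)) :=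
      Real.one_le_exp (by linarith [h.e_nonneg hτ, h.r_nonneg τ hτ])
    nlinarith [h.e_nonneg hτ, h.r_nonneg τ hτ]
  · have h1 : Real.exp (4 * (e 0 + r 0)) ≤ Real.exp 4 :=
      Real.exp_le_exp.2 (by linarith [h.e_le 0 le_rfl, h.r_le_e 0 le_rfl])
    have h2 := mul_le_mul h0 h1 (Real.exp_pos _).le (mul_pos hC (h.x_pos 0 le_rfl)).le
    linarith
  · intro z hz hneg
    have he := h.e_nonneg hz
    have hr := h.r_nonneg z hz
    have hre := h.r_le_e z hz
    have hem := h.e_le z hz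
    have hE := Real.exp_pos (4 * (e z + r z))
    generalize Real.exp (4 * (e z + r z)) = A at *
    simp only [Pi.add_apply] at *
    generalize C * Real.exp 4 = K at *
    generalize e z = e at *
    generalize r z = r at *
    generalize x z = x at *
    have h1 : 0 ≤ (e + 1 / 2) * ((e + r) * A - K * x) :=
      mul_nonneg (by linarith) (by linarith)
    have h3 : r * e * (e + r) ≤ r * e * 1 :=
      mul_le_mul_of_nonneg_left (by linarith) (mul_nonneg hr he)
    have h2 : 0 ≤ A * (e ^ 2 + 2 * e * r + 2 * r ^ 2 - 4 * r * e * (e + r)) :=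
      mul_nonneg hE.le (by nlinarith [sq_nonneg (e - r), sq_nonneg r])
    nlinarith

theorem e_zero_sub_le (h : IsCharacteristic m e r x t) {K : ℝ}
    (hK : ∀ z, 0 ≤ z → e z ≤ K * x z) (hτ : 0 ≤ τ) : |e 0 - e τ| ≤ K * t τ := by
  have h1 := nonneg_of_hasDerivAt_nonneg (f := fun z => e 0 - e z) (by simp)
    (fun z hz => (h.hasDerivAt_e z hz).const_sub (e 0))
    (fun z hz => by linarith [h.r_le_e z hz]) hτ
  have h2 := nonneg_of_hasDerivAt_nonneg (f := fun z => K * t z - (e 0 - e z))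
    (by simp [h.t_zero])
    (fun z hz => ((h.hasDerivAt_t z hz).const_mul K).sub ((h.hasDerivAt_e z hz).const_sub (e 0)))
    (fun z hz => by linarith [h.r_nonneg z hz, hK z hz, h.e_nonneg hz]) hτ
  rw [abs_of_nonneg h1]
  linarith

theorem r_zero_sub_le (h : IsCharacteristic m e r x t) {K : ℝ} (hm : m ≤ 1)
    (hK : ∀ z, 0 ≤ z → e z ≤ K * x z) (hτ : 0 ≤ τ) : |r 0 - r τ| ≤ K * t τ := by
  have h1 := nonneg_of_hasDerivAt_nonneg (f := fun z => r 0 - r z) (by simp)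
    (fun z hz => (h.hasDerivAt_r z hz).const_sub (r 0))
    (fun z hz => by
      have := mul_nonneg (h.r_nonneg z hz) (by linarith [h.e_le z hz] : 0 ≤ 1 - e z)
      linarith) hτ
  have h2 := nonneg_of_hasDerivAt_nonneg (f := fun z => K * t z - (r 0 - r z))
    (by simp [h.t_zero])
    (fun z hz => ((h.hasDerivAt_t z hz).const_mul K).sub ((h.hasDerivAt_r z hz).const_sub (r 0)))
    (fun z hz => by
      have := mul_nonneg (h.r_nonneg z hz) (h.e_nonneg hz)
      linarith [h.r_le_e z hz, hK z hz]) hτ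
  rw [abs_of_nonneg h1]
  linarith

theorem hasDerivAt_value (h : IsCharacteristic m e r x t) (hτ : 0 ≤ τ) :
    HasDerivAt (fun z => x z * (m - (e z + r z) / 2))
      (x τ * (-((e τ + 1 / 2) * (m - e τ)) + (r τ - e τ ^ 2) / 2)) τ :=
  ((h.hasDerivAt_x τ hτ).mul ((((h.hasDerivAt_e τ hτ).add
    (h.hasDerivAt_r τ hτ)).div_const 2).const_sub m)).congr_deriv (by ring_nf; simp; ring)

theorem value_le (h : IsCharacteristic m e r x t) (hτ : 0 ≤ τ) :
    x τ * (m - (e τ + r τ) / 2) ≤ x 0 * (m - (e 0 + r 0) / 2) + m * t τ := by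
  have := nonneg_of_hasDerivAt_nonneg (f := fun z => x 0 * (m - (e 0 + r 0) / 2) + m * t z
      - x z * (m - (e z + r z) / 2)) (by simp [h.t_zero])
    (fun z hz => (((h.hasDerivAt_t z hz).const_mul m).const_add _).sub (h.hasDerivAt_value hz))
    (fun z hz => by
      have h1 : 0 ≤ x z * (m + (e z + 1 / 2) * (m - e z) - (r z - e z ^ 2) / 2) := by
        refine mul_nonneg (h.x_pos z hz).le ?_
        have := mul_nonneg (by linarith [h.e_nonneg hz] : 0 ≤ e z + 1 / 2)
          (sub_nonneg.2 (h.e_le z hz))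
        nlinarith [h.r_le_e z hz, h.e_le z hz, h.e_nonneg hz]
      linarith) hτ
  linarith

theorem abs_value_sub_le (h : IsCharacteristic m e r x t) (hm : m ≤ 1 / 2) (hτ : 0 ≤ τ) :
    |x τ * (m - (e τ + r τ) / 2) - x 0 * (m - (e 0 + r 0) / 2)| ≤ t τ := by
  have hb : ∀ z, 0 ≤ z → |-((e z + 1 / 2) * (m - e z)) + (r z - e z ^ 2) / 2| ≤ 1 := by
    intro z hz
    have h1 := h.e_nonneg hz
    have h2 := h.e_le z hz
    have h3 := h.r_nonneg z hz
    have h4 := h.r_le_e z hz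
    have h5 := mul_nonneg (by linarith : 0 ≤ e z + 1 / 2) (sub_nonneg.2 h2)
    rw [abs_le]
    constructor <;> nlinarith
  rw [abs_le]
  constructor
  · have := nonneg_of_hasDerivAt_nonneg (f := fun z => t z + (x z * (m - (e z + r z) / 2)
      - x 0 * (m - (e 0 + r 0) / 2))) (by simp [h.t_zero])
      (fun z hz => (h.hasDerivAt_t z hz).add ((h.hasDerivAt_value hz).sub_const _))
      (fun z hz => by nlinarith [(abs_le.1 (hb z hz)).1, h.x_pos z hz]) hτ
    linarith
  · have := nonneg_of_hasDerivAt_nonneg (f := fun z => t z - (x z * (m - (e z + r z) / 2)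
      - x 0 * (m - (e 0 + r 0) / 2))) (by simp [h.t_zero])
      (fun z hz => (h.hasDerivAt_t z hz).sub ((h.hasDerivAt_value hz).sub_const _))
      (fun z hz => by nlinarith [(abs_le.1 (hb z hz)).2, h.x_pos z hz]) hτ
    linarith

end IsCharacteristic

end CharacteristicEstimates

section VariationalEquation

open scoped Topology ContDiff

/-- A cooperative planar linear system started in the closed quadrant `J > 0`, `D ≥ 0`
keeps `J > 0`. -/
theorem pos_of_cooperative {J D e r : ℝ → ℝ} {k m : ℝ} (hk : 0 ≤ k)
    (hJ : ∀ s ∈ Icc (0 : ℝ) 1, HasDerivAt J (k * (-(e s * J s) + D s)) s)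
    (hD : ∀ s ∈ Icc (0 : ℝ) 1, HasDerivAt D (k * (-(3 / 2 * D s) + 3 / 2 * (r s * J s))) s)
    (he : ∀ s ∈ Icc (0 : ℝ) 1, 0 ≤ e s) (hem : ∀ s ∈ Icc (0 : ℝ) 1, e s ≤ m)
    (hr : ∀ s ∈ Icc (0 : ℝ) 1, 0 ≤ r s) (hJ0 : J 0 = 1) (hD0 : 0 ≤ D 0) : 0 < J 1 := by
  have hP : ∀ s ∈ Icc (0 : ℝ) 1, 0 ≤ J s * D s := by
    intro s hs
    have hsub : ∀ z ∈ Icc 0 s, z ∈ Icc (0 : ℝ) 1 := fun z hz => ⟨hz.1, hz.2.trans hs.2⟩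
    refine nonneg_of_hasDerivAt_of_neg_imp_Icc (f := fun z => J z * D z) hs.1
      (by rw [hJ0, one_mul]; exact hD0)
      (fun z hz => (hJ z (hsub z hz)).mul (hD z (hsub z hz))) fun z hz hneg => ?_
    have h1 : 0 ≤ k * (D z ^ 2 + 3 / 2 * (r z * J z ^ 2) + (e z + 3 / 2) * (-(J z * D z))) := by
      have h2 := he z (hsub z hz)
      have h3 := hr z (hsub z hz)
      have h4 := mul_nonneg (by linarith : 0 ≤ e z + 3 / 2) (neg_nonneg.2 hneg.le)
      positivity
    linarith
  have hne : ∀ s ∈ Icc (0 : ℝ) 1, J s ≠ 0 := by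
    intro s hs hzero
    have hsub : ∀ z ∈ Icc 0 s, z ∈ Icc (0 : ℝ) 1 := fun z hz => ⟨hz.1, hz.2.trans hs.2⟩
    have := nonneg_of_hasDerivAt_of_neg_imp_Icc
      (f := fun z => J z ^ 2 * Real.exp (2 * k * m * z) - 1) hs.1 (by simp [hJ0])
      (fun z hz => (((hJ z (hsub z hz)).pow 2).mul
        (((hasDerivAt_id z).const_mul (2 * k * m)).exp)).sub_const 1) fun z hz _ => ?_
    · simp only [hzero] at this
      norm_num at this
    · have h1 := hP z (hsub z hz)
      have h2 : 0 ≤ m - e z := sub_nonneg.2 (hem z (hsub z hz))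
      have h3 := (Real.exp_pos (2 * k * m * z)).le
      have h4 : 0 ≤ 2 * k * (J z * D z + (m - e z) * J z ^ 2) * Real.exp (2 * k * m * z) := by
        positivity
      simp only [id, Nat.cast_ofNat, Nat.add_one_sub_one, pow_one, Pi.pow_apply]
      linarith
  by_contra! hle
  have hc : ContinuousOn J (Icc 0 1) := fun s hs => (hJ s hs).continuousAt.continuousWithinAt
  obtain ⟨s, hs, hs0⟩ := intermediate_value_Icc' zero_le_one hc ⟨hle, by rw [hJ0]; norm_num⟩
  exact hne s hs hs0

/-- The linear part of the characteristic vector field in the variables `(e, r, x, t)`. -/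
noncomputable def charLinear : (ℝ × ℝ × ℝ × ℝ) →L[ℝ] (ℝ × ℝ × ℝ × ℝ) :=
  LinearMap.toContinuousLinearMap
    { toFun := fun U => (-(U.1 - U.2.1) / 2, -U.2.1, -U.2.2.1 / 2, U.2.2.1)
      map_add' := fun U V => by simp; exact ⟨by ring, by ring, by ring⟩
      map_smul' := fun c U => by simp; exact ⟨by ring, by ring⟩ }

/-- The quadratic part of the characteristic vector field in the variables `(e, r, x, t)`. -/
noncomputable def charBilinear :
    (ℝ × ℝ × ℝ × ℝ) →L[ℝ] (ℝ × ℝ × ℝ × ℝ) →L[ℝ] (ℝ × ℝ × ℝ × ℝ) :=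
  LinearMap.toContinuousBilinearMap
    (LinearMap.mk₂ ℝ (fun U V => (0, U.2.1 * V.1, -(U.2.2.1 * V.1), 0))
      (fun U U' V => by simp; exact ⟨by ring, by ring⟩)
      (fun c U V => by simp; exact ⟨by ring, by ring⟩)
      (fun U V V' => by simp; exact ⟨by ring, by ring⟩)
      (fun c U V => by simp; exact ⟨by ring, by ring⟩))

theorem charLinear_apply (U : ℝ × ℝ × ℝ × ℝ) :
    charLinear U = (-(U.1 - U.2.1) / 2, -U.2.1, -U.2.2.1 / 2, U.2.2.1) := rfl

theorem charBilinear_apply (U V : ℝ × ℝ × ℝ × ℝ) :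
    charBilinear U V = (0, U.2.1 * V.1, -(U.2.2.1 * V.1), 0) := rfl

/-- The family of characteristics of the Hamilton-Jacobi equation with initial data `g`,
indexed by their initial position. -/
structure IsCharacteristicFlow (m : ℝ) (g : ℝ → ℝ) (e r x t : ℝ → ℝ → ℝ) : Prop where
  isCharacteristic : ∀ y, 0 < y → IsCharacteristic m (e y) (r y) (x y) (t y)
  e_zero : ∀ y, 0 < y → e y 0 = m - deriv g y
  r_zero : ∀ y, 0 < y → r y 0 = m - 2 * (g y / y) + deriv g y
  x_zero : ∀ y, 0 < y → x y 0 = y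

theorem AdmissibleData.exists_isCharacteristicFlow {m C : ℝ} {g : ℝ → ℝ} (hm : m ≤ 1)
    (hg : AdmissibleData m C g) : ∃ e r x t, IsCharacteristicFlow m g e r x t := by
  have : ∀ y : ℝ, ∃ e r x t : ℝ → ℝ, 0 < y → e 0 = m - deriv g y ∧
      r 0 = m - 2 * (g y / y) + deriv g y ∧ x 0 = y ∧ IsCharacteristic m e r x t := by
    intro y
    by_cases hy : 0 < y
    · have h1 := hg.two_mul_le y hy
      have h2 := hg.mul_deriv_le y hy
      have h3 := hg.deriv_nonneg y hy
      have h4 : y * (g y / y) = g y := by field_simp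
      obtain ⟨e, r, x, t, h⟩ := exists_isCharacteristic (e₀ := m - deriv g y)
        (r₀ := m - 2 * (g y / y) + deriv g y) hm
        (le_of_mul_le_mul_left (by linarith) hy) (le_of_mul_le_mul_left (by linarith) hy)
        (by linarith) hy
      exact ⟨e, r, x, t, fun _ => h⟩
    · exact ⟨0, 0, 0, 0, fun h => absurd h hy⟩
  choose e r x t h using this
  exact ⟨e, r, x, t, fun y hy => (h y hy).2.2.2, fun y hy => (h y hy).1,
    fun y hy => (h y hy).2.1, fun y hy => (h y hy).2.2.1⟩

namespace IsCharacteristicFlow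

variable {m C : ℝ} {g : ℝ → ℝ} {e r x t : ℝ → ℝ → ℝ} {y τ : ℝ}

theorem hasDerivAt_state (h : IsCharacteristicFlow m g e r x t) (hy : 0 < y) (hτ : 0 ≤ τ) :
    HasDerivAt (fun z => (e y z, r y z, x y z, t y z))
      (-(e y τ - r y τ) / 2, -(r y τ * (1 - e y τ)), -(x y τ * (e y τ + 1 / 2)), x y τ) τ :=
  have hc := h.isCharacteristic y hy
  (hc.hasDerivAt_e τ hτ).prodMk ((hc.hasDerivAt_r τ hτ).prodMk
    ((hc.hasDerivAt_x τ hτ).prodMk (hc.hasDerivAt_t τ hτ)))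

theorem exists_hasFDerivAt (h : IsCharacteristicFlow m g e r x t)
    (hg : AdmissibleData m C g) (hy : 0 < y) (hτ : 0 < τ) :
    ContDiffAt ℝ ∞ (fun P : ℝ × ℝ => (e P.1 P.2, r P.1 P.2, x P.1 P.2, t P.1 P.2)) (y, τ) ∧
    ∃ δe δr δx δt : ℝ, 0 < δx + (e y τ + 1 / 2) * δt ∧
      (e y τ - r y τ) / 2 * δx - x y τ * (δe + δr) / 2 - (r y τ - e y τ ^ 2) / 2 * δt = 0 ∧
      fderiv ℝ (fun P : ℝ × ℝ => (e P.1 P.2, r P.1 P.2, x P.1 P.2, t P.1 P.2)) (y, τ) (1, 0)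
        = (δe, δr, δx, δt) := by
  have hc := h.isCharacteristic y hy
  have hgy := hg.contDiffAt y hy
  have hd1 : ContDiffAt ℝ ∞ (deriv g) y :=
    (hgy.fderiv_right (m := ∞) (by simp)).clm_apply contDiffAt_const
  have ha : ContDiffAt ℝ ∞ (fun z => ((m - deriv g z, m - 2 * (g z / z) + deriv g z, z, 0) :
      ℝ × ℝ × ℝ × ℝ)) y :=
    (contDiffAt_const.sub hd1).prodMk (((contDiffAt_const.sub (contDiffAt_const.mul
      (hgy.div contDiffAt_id hy.ne'))).add hd1).prodMk (contDiffAt_id.prodMk contDiffAt_const))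
  have hda : HasDerivAt (fun z => ((m - deriv g z, m - 2 * (g z / z) + deriv g z, z, 0) :
      ℝ × ℝ × ℝ × ℝ)) (-deriv (deriv g) y,
        -(2 * ((deriv g y * y - g y * 1) / y ^ 2)) + deriv (deriv g) y, 1, 0) y := by
    have h1 := (hgy.differentiableAt (by simp)).hasDerivAt
    have h2 := (hd1.differentiableAt (by simp)).hasDerivAt
    exact (h2.const_sub m).prodMk (((((h1.div (hasDerivAt_id y) hy.ne').const_mul 2).const_sub
      m).add h2).prodMk ((hasDerivAt_id y).prodMk (hasDerivAt_const y 0)))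
  have hpos : ∀ᶠ z in 𝓝 y, 0 < z := lt_mem_nhds hy
  obtain ⟨hsm, v, hv0, hv, hfd⟩ := contDiffAt_quadratic_flow charLinear charBilinear
    (u := fun y τ => (e y τ, r y τ, x y τ, t y τ)) hτ ha
    (hpos.mono fun z hz => by
      simp only [h.e_zero z hz, h.r_zero z hz, h.x_zero z hz, (h.isCharacteristic z hz).t_zero])
    (hpos.mono fun z hz σ hσ => (h.hasDerivAt_state hz hσ).congr_deriv (by
      simp only [charLinear_apply, charBilinear_apply, Prod.mk_add_mk, Prod.mk.injEq]
      exact ⟨by ring, by ring, by ring, by ring⟩))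
  simp only [charLinear_apply, charBilinear_apply, Prod.mk_add_mk, Prod.smul_mk,
    smul_eq_mul] at hv
  have dδe : ∀ s ∈ Icc (0 : ℝ) 1, HasDerivAt (fun s => (v s).1) _ s := fun s hs =>
    (hv s hs).fst_comp
  have dδr : ∀ s ∈ Icc (0 : ℝ) 1, HasDerivAt (fun s => (v s).2.1) _ s := fun s hs =>
    (hv s hs).snd_comp.fst_comp
  have dδx : ∀ s ∈ Icc (0 : ℝ) 1, HasDerivAt (fun s => (v s).2.2.1) _ s := fun s hs =>
    (hv s hs).snd_comp.snd_comp.fst_comp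
  have dδt : ∀ s ∈ Icc (0 : ℝ) 1, HasDerivAt (fun s => (v s).2.2.2) _ s := fun s hs =>
    (hv s hs).snd_comp.snd_comp.snd_comp
  have hst : ∀ s ∈ Icc (0 : ℝ) 1, 0 ≤ s * τ := fun s hs => mul_nonneg hs.1 hτ.le
  have de : ∀ s ∈ Icc (0 : ℝ) 1, HasDerivAt (fun s => e y (s * τ)) _ s := fun s hs =>
    (hc.hasDerivAt_e _ (hst s hs)).comp s ((hasDerivAt_id s).mul_const τ)
  have dr : ∀ s ∈ Icc (0 : ℝ) 1, HasDerivAt (fun s => r y (s * τ)) _ s := fun s hs =>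
    (hc.hasDerivAt_r _ (hst s hs)).comp s ((hasDerivAt_id s).mul_const τ)
  have dx : ∀ s ∈ Icc (0 : ℝ) 1, HasDerivAt (fun s => x y (s * τ)) _ s := fun s hs =>
    (hc.hasDerivAt_x _ (hst s hs)).comp s ((hasDerivAt_id s).mul_const τ)
  rw [hda.deriv] at hv0
  have hv0' : (v 0).1 = -deriv (deriv g) y ∧ (v 0).2.1 =
      -(2 * ((deriv g y * y - g y * 1) / y ^ 2)) + deriv (deriv g) y ∧ (v 0).2.2.1 = 1 ∧
      (v 0).2.2.2 = 0 := by
    rw [hv0]; exact ⟨rfl, rfl, rfl, rfl⟩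
  obtain ⟨hv1, hv2, hv3, hv4⟩ := hv0'
  have hcons : ∀ s ∈ Icc (0 : ℝ) 1, (e y (s * τ) - r y (s * τ)) / 2 * (v s).2.2.1
      - x y (s * τ) * ((v s).1 + (v s).2.1) / 2
      - (r y (s * τ) - e y (s * τ) ^ 2) / 2 * (v s).2.2.2 = 0 := by
    set c : ℝ → ℝ := fun s => (e y (s * τ) - r y (s * τ)) / 2 * (v s).2.2.1
      - x y (s * τ) * ((v s).1 + (v s).2.1) / 2
      - (r y (s * τ) - e y (s * τ) ^ 2) / 2 * (v s).2.2.2 with hcdef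
    have hc0 : c 0 = 0 := by
      simp only [hcdef, hv1, hv2, hv3, hv4, zero_mul, h.e_zero y hy, h.r_zero y hy,
        h.x_zero y hy]
      field_simp
      ring
    have dc : ∀ s ∈ Icc (0 : ℝ) 1, HasDerivAt c (-(τ * c s)) s := fun s hs => by
      refine ((((((de s hs).sub (dr s hs)).div_const 2).mul (dδx s hs)).sub
        (((dx s hs).mul ((dδe s hs).add (dδr s hs))).div_const 2)).sub
        ((((dr s hs).sub ((de s hs).pow 2)).div_const 2).mul (dδt s hs))).congr_deriv ?_
      simp only [hcdef, Pi.sub_apply, Pi.add_apply, Pi.pow_apply]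
      push_cast
      ring
    intro s hs
    have hsub : ∀ z ∈ Icc 0 s, z ∈ Icc (0 : ℝ) 1 := fun z hz => ⟨hz.1, hz.2.trans hs.2⟩
    refine le_antisymm ?_ ?_
    · refine neg_nonneg.1 (nonneg_of_hasDerivAt_of_neg_imp_Icc (f := fun s => -c s) hs.1
        (by simp [hc0]) (fun z hz => (dc z (hsub z hz)).neg) fun z _ hz => ?_)
      nlinarith
    · refine nonneg_of_hasDerivAt_of_neg_imp_Icc (f := c) hs.1 hc0.ge
        (fun z hz => dc z (hsub z hz)) fun z _ hz => ?_
      nlinarith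
  have h1 : (1 : ℝ) ∈ Icc (0 : ℝ) 1 := ⟨zero_le_one, le_rfl⟩
  refine ⟨hsm, (v 1).1, (v 1).2.1, (v 1).2.2.1, (v 1).2.2.2, ?_, ?_, hfd⟩
  · have := pos_of_cooperative (k := τ) (m := m) (e := fun s => e y (s * τ))
      (r := fun s => r y (s * τ))
      (J := fun s => (v s).2.2.1 + (e y (s * τ) + 1 / 2) * (v s).2.2.2)
      (D := fun s => e y (s * τ) * ((v s).2.2.1 + (e y (s * τ) + 1 / 2) * (v s).2.2.2)
        - (x y (s * τ) * (v s).1 + (e y (s * τ) - r y (s * τ)) / 2 * (v s).2.2.2)) hτ.le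
      (fun s hs => ((dδx s hs).add (((de s hs).add_const (1 / 2)).mul (dδt s hs))).congr_deriv
        (by ring))
      (fun s hs => by
        have dJ := (dδx s hs).add (((de s hs).add_const (1 / 2)).mul (dδt s hs))
        refine (((de s hs).mul dJ).sub (((dx s hs).mul (dδe s hs)).add
          ((((de s hs).sub (dr s hs)).div_const 2).mul (dδt s hs)))).congr_deriv ?_
        simp only [Pi.sub_apply, Pi.add_apply, Pi.mul_apply]
        linear_combination τ * hcons s hs)
      (fun s hs => hc.e_nonneg (hst s hs)) (fun s hs => hc.e_le _ (hst s hs))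
      (fun s hs => hc.r_nonneg _ (hst s hs)) (by simp [hv3, hv4]) (by
        have := hg.deriv_sub_le y hy
        simp only [hv1, hv3, hv4, zero_mul, h.e_zero y hy, h.x_zero y hy]
        linarith)
    simpa using this
  · simpa using hcons 1 h1

end IsCharacteristicFlow

end VariationalEquation

section InverseFlow

open scoped Topology ContDiff

/-- A smooth map of the finite-dimensional space `E` with injective derivative at `P` has a
smooth local right inverse. -/
theorem ContDiffAt.exists_local_right_inverse {E : Type*} [NormedAddCommGroup E]
    [NormedSpace ℝ E] [FiniteDimensional ℝ E] [CompleteSpace E] {Φ : E → E} {P : E}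
    (hΦ : ContDiffAt ℝ ∞ Φ P) (hinj : ∀ v, fderiv ℝ Φ P v = 0 → v = 0) :
    ∃ Ψ : E → E, Ψ (Φ P) = P ∧ ContDiffAt ℝ ∞ Ψ (Φ P) ∧ ∀ᶠ q in 𝓝 (Φ P), Φ (Ψ q) = q := by
  have hn : (∞ : WithTop ℕ∞) ≠ 0 := by simp
  let A : E ≃L[ℝ] E := (LinearEquiv.ofInjectiveEndo (fderiv ℝ Φ P).toLinearMap
    ((injective_iff_map_eq_zero _).2 hinj)).toContinuousLinearEquiv
  have hA : HasFDerivAt Φ (A : E →L[ℝ] E) P := by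
    refine (hΦ.differentiableAt hn).hasFDerivAt.congr_fderiv ?_
    ext v
    rfl
  exact ⟨hΦ.localInverse hA hn, hΦ.localInverse_apply_image hA hn, hΦ.to_localInverse hA hn,
    (hΦ.hasStrictFDerivAt' hA hn).eventually_right_inverse⟩

namespace IsCharacteristicFlow

variable {m C : ℝ} {g : ℝ → ℝ} {e r x t : ℝ → ℝ → ℝ} {y τ : ℝ}

theorem exists_fderiv_apply_eq (h : IsCharacteristicFlow m g e r x t)
    (hg : AdmissibleData m C g) (hy : 0 < y) (hτ : 0 < τ) :
    ContDiffAt ℝ ∞ (fun P : ℝ × ℝ => (e P.1 P.2, r P.1 P.2, x P.1 P.2, t P.1 P.2)) (y, τ) ∧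
    ∃ δe δr δx δt : ℝ, 0 < δx + (e y τ + 1 / 2) * δt ∧
      (e y τ - r y τ) / 2 * δx - x y τ * (δe + δr) / 2 - (r y τ - e y τ ^ 2) / 2 * δt = 0 ∧
      HasFDerivAt (fun P : ℝ × ℝ => (e P.1 P.2, r P.1 P.2, x P.1 P.2, t P.1 P.2))
        (.toSpanSingleton ℝ (δe, δr, δx, δt) ∘L .fst ℝ ℝ ℝ
          + .toSpanSingleton ℝ (-(e y τ - r y τ) / 2, -(r y τ * (1 - e y τ)),
            -(x y τ * (e y τ + 1 / 2)), x y τ) ∘L .snd ℝ ℝ ℝ) (y, τ) := by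
  obtain ⟨hs, δe, δr, δx, δt, hJ, hc, hd⟩ := h.exists_hasFDerivAt hg hy hτ
  refine ⟨hs, δe, δr, δx, δt, hJ, hc, ?_⟩
  have hf := (hs.differentiableAt (by simp)).hasFDerivAt
  have h1 : fderiv ℝ (fun P : ℝ × ℝ => (e P.1 P.2, r P.1 P.2, x P.1 P.2, t P.1 P.2)) (y, τ)
      (0, 1) = _ :=
    (hf.comp_hasDerivAt τ ((hasDerivAt_const τ y).prodMk (hasDerivAt_id τ))).unique
      (h.hasDerivAt_state hy hτ.le)
  refine hf.congr_fderiv ?_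
  refine ContinuousLinearMap.prod_ext (ContinuousLinearMap.ext_ring ?_)
    (ContinuousLinearMap.ext_ring ?_)
  · simpa using hd
  · simpa using h1

end IsCharacteristicFlow

end InverseFlow

section ArrivalTime

open scoped Topology ContDiff

namespace IsCharacteristicFlow

variable {m C : ℝ} {g : ℝ → ℝ} {e r x t : ℝ → ℝ → ℝ} {y τ : ℝ}

theorem x_lt (h : IsCharacteristicFlow m g e r x t) (hy : 0 < y) (hτ : 0 < τ) : x y τ < y := by
  have := (h.isCharacteristic y hy).strictAntiOn (mem_Ici.2 le_rfl) (mem_Ici.2 hτ.le) hτ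
  rwa [h.x_zero y hy] at this

theorem exists_arrival (h : IsCharacteristicFlow m g e r x t) (hg : AdmissibleData m C g)
    {x₁ : ℝ} (hx₁ : 0 < x₁) : ∃ σ : ℝ → ℝ, ∀ y, x₁ < y → 0 < σ y ∧ x y (σ y) = x₁ ∧
      ∃ d, 0 < d ∧ HasDerivAt (fun y => t y (σ y)) d y := by
  have hex : ∀ y, ∃ σ, x₁ < y → 0 < σ ∧ x y σ = x₁ := by
    intro y
    by_cases hy : x₁ < y
    · have hy0 := hx₁.trans hy
      obtain ⟨σ, h1, h2⟩ := (h.isCharacteristic y hy0).exists_x_eq hx₁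
        (by rwa [h.x_zero y hy0])
      exact ⟨σ, fun _ => ⟨h1, h2⟩⟩
    · exact ⟨0, fun h => absurd h hy⟩
  choose σ hσ using hex
  refine ⟨σ, fun y hy => ⟨(hσ y hy).1, (hσ y hy).2, ?_⟩⟩
  obtain ⟨hσ0, hσx⟩ := hσ y hy
  have hy0 := hx₁.trans hy
  have hc := h.isCharacteristic y hy0
  obtain ⟨hsm, δe, δr, δx, δt, hJ, -, hd⟩ := h.exists_fderiv_apply_eq hg hy0 hσ0
  have he : 0 < e y (σ y) + 1 / 2 := by linarith [hc.e_nonneg hσ0.le]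
  have hxc : ContDiffAt ℝ ∞ (fun P : ℝ × ℝ => x P.1 P.2) (y, σ y) := hsm.snd.snd.fst
  have hxd := hd.snd.snd.fst
  have htd := hd.snd.snd.snd
  have hinj : ∀ v, fderiv ℝ (fun P : ℝ × ℝ => (P.1, x P.1 P.2)) (y, σ y) v = 0 → v = 0 := by
    intro v hv
    rw [(hasFDerivAt_fst.prodMk hxd).fderiv] at hv
    simp [hσx] at hv
    obtain ⟨hv1, hv2⟩ := hv
    rw [hv1] at hv2
    have : v.2 = 0 := by
      rcases (by simpa using hv2 : v.2 = 0 ∨ x₁ = 0 ∨ e y (σ y) + 2⁻¹ = 0) with h | h | h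
      · exact h
      · linarith
      · norm_num at he; linarith
    exact Prod.ext hv1 this
  obtain ⟨Ψ, hΨ0, hΨ, hΨr⟩ := ContDiffAt.exists_local_right_inverse
    (contDiffAt_fst.prodMk hxc) hinj
  simp only [hσx] at hΨ0 hΨ hΨr
  have hcurve : HasDerivAt (fun z : ℝ => (z, x₁)) ((1 : ℝ), (0 : ℝ)) y :=
    (hasDerivAt_id y).prodMk (hasDerivAt_const y x₁)
  have hdΨ : HasDerivAt (fun z => (Ψ (z, x₁)).2) _ y :=
    ((hΨ.differentiableAt (by simp)).hasFDerivAt.comp_hasDerivAt y hcurve).snd_comp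
  have hpos : ∀ᶠ z in 𝓝 y, 0 < (Ψ (z, x₁)).2 :=
    hdΨ.continuousAt.eventually_const_lt (by beta_reduce; rw [hΨ0]; exact hσ0)
  have hσΨ : σ =ᶠ[𝓝 y] fun z => (Ψ (z, x₁)).2 := by
    filter_upwards [hpos, hcurve.continuousAt.eventually hΨr, lt_mem_nhds hy] with z h1 h2 h3
    rw [Prod.mk.injEq] at h2
    rw [h2.1] at h2
    have h4 := hσ z h3
    exact (h.isCharacteristic z (hx₁.trans h3)).strictAntiOn.injOn (mem_Ici.2 h4.1.le)
      (mem_Ici.2 h1.le) (h4.2.trans h2.2.symm)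
  have hdσ := hdΨ.congr_of_eventuallyEq hσΨ
  set σ' := (fderiv ℝ Ψ (y, x₁) (1, 0)).2
  have hcσ : HasDerivAt (fun z => (z, σ z)) (1, σ') y := (hasDerivAt_id y).prodMk hdσ
  have hdx : HasDerivAt (fun z => x z (σ z)) (δx - x₁ * (e y (σ y) + 1 / 2) * σ') y := by
    refine (HasFDerivAt.comp_hasDerivAt y (l := fun P : ℝ × ℝ => x P.1 P.2) hxd
      hcσ).congr_deriv ?_
    simp [hσx]
    ring
  have hdt : HasDerivAt (fun z => t z (σ z)) (δt + x₁ * σ') y := by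
    refine (HasFDerivAt.comp_hasDerivAt y (l := fun P : ℝ × ℝ => t P.1 P.2) htd
      hcσ).congr_deriv ?_
    simp [hσx]
    ring
  refine ⟨_, ?_, hdt⟩
  have h0 : δx - x₁ * (e y (σ y) + 1 / 2) * σ' = 0 :=
    hdx.unique ((hasDerivAt_const y x₁).congr_of_eventuallyEq
      ((lt_mem_nhds hy).mono fun z hz => (hσ z hz).2))
  refine pos_of_mul_pos_right (a := e y (σ y) + 1 / 2) ?_ he.le
  linarith

theorem existsUnique_foot (h : IsCharacteristicFlow m g e r x t) (hg : AdmissibleData m C g)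
    {x₁ t₁ : ℝ} (hx₁ : 0 < x₁) (ht₁ : 0 < t₁) :
    ∃! P : ℝ × ℝ, (0 < P.1 ∧ 0 < P.2) ∧ x P.1 P.2 = x₁ ∧ t P.1 P.2 = t₁ := by
  obtain ⟨σ, hσ⟩ := h.exists_arrival hg hx₁
  have hc := h.isCharacteristic x₁ hx₁
  have hm : 0 ≤ m := (hc.e_nonneg le_rfl).trans (hc.e_le 0 le_rfl)
  have hcont : ContinuousOn (fun y => t y (σ y)) (Ioi x₁) := fun y hy => by
    obtain ⟨-, -, d, -, hd⟩ := hσ y hy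
    exact hd.continuousAt.continuousWithinAt
  have hmono : StrictMonoOn (fun y => t y (σ y)) (Ioi x₁) := by
    refine strictMonoOn_of_deriv_pos (convex_Ioi x₁) hcont fun y hy => ?_
    rw [interior_Ioi] at hy
    obtain ⟨-, -, d, hd0, hd⟩ := hσ y hy
    rwa [hd.deriv]
  have hle : ∀ y, x₁ < y → t y (σ y) ≤ 2 * (y - x₁) := fun y hy => by
    have := (h.isCharacteristic y (hx₁.trans hy)).t_le (hσ y hy).1.le
    rwa [(hσ y hy).2.1, h.x_zero y (hx₁.trans hy)] at this
  have hge : ∀ y, x₁ < y → y - x₁ ≤ (m + 1 / 2) * t y (σ y) := fun y hy => by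
    have := (h.isCharacteristic y (hx₁.trans hy)).sub_le (hσ y hy).1.le
    rwa [(hσ y hy).2.1, h.x_zero y (hx₁.trans hy)] at this
  have hmt := mul_nonneg hm ht₁.le
  have ha : x₁ < x₁ + t₁ / 4 := by linarith
  have hb : x₁ < x₁ + (m + 1 / 2) * t₁ := by linarith
  have hmem : t₁ ∈ Icc (t (x₁ + t₁ / 4) (σ (x₁ + t₁ / 4)))
      (t (x₁ + (m + 1 / 2) * t₁) (σ (x₁ + (m + 1 / 2) * t₁))) :=
    ⟨by linarith [hle _ ha],
      le_of_mul_le_mul_left (by linarith [hge _ hb]) (by linarith : 0 < m + 1 / 2)⟩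
  obtain ⟨y, hy, hyt⟩ := intermediate_value_Icc (by linarith)
    (hcont.mono fun z hz => ha.trans_le hz.1) hmem
  have hy' : x₁ < y := ha.trans_le hy.1
  refine ⟨(y, σ y), ⟨⟨hx₁.trans hy', (hσ y hy').1⟩, (hσ y hy').2.1, hyt⟩, ?_⟩
  rintro ⟨z, τ⟩ ⟨⟨hz, hτ⟩, hzx, hzt⟩
  simp only at hz hτ hzx hzt
  have hzx₁ : x₁ < z := hzx ▸ h.x_lt hz hτ
  have hτσ : τ = σ z := (h.isCharacteristic z hz).strictAntiOn.injOn (mem_Ici.2 hτ.le)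
    (mem_Ici.2 (hσ z hzx₁).1.le) (hzx.trans (hσ z hzx₁).2.1.symm)
  subst hτσ
  rw [hmono.injOn hzx₁ hy' (hzt.trans hyt.symm)]

end IsCharacteristicFlow

end ArrivalTime

section ClassicalSolution

open scoped Topology ContDiff

/-- A classical solution `G` of the Hamilton-Jacobi equation on the open quadrant, with
gradient `(m - E, (R - E ^ 2) / 2)`, which attains its initial data `g` together with
its gradient. -/
structure IsClassicalSolution (m A K : ℝ) (g : ℝ → ℝ) (G E R : ℝ × ℝ → ℝ) : Prop where
  contDiffAt : ∀ p : ℝ × ℝ, 0 < p.1 → 0 < p.2 → ContDiffAt ℝ ∞ G p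
  hasFDerivAt : ∀ p : ℝ × ℝ, 0 < p.1 → 0 < p.2 → HasFDerivAt G
    ((m - E p) • .fst ℝ ℝ ℝ + ((R p - E p ^ 2) / 2) • .snd ℝ ℝ ℝ) p
  eq_mul : ∀ p : ℝ × ℝ, 0 < p.1 → 0 < p.2 → G p = p.1 * (m - (E p + R p) / 2)
  R_nonneg : ∀ p : ℝ × ℝ, 0 < p.1 → 0 < p.2 → 0 ≤ R p
  R_le_E : ∀ p : ℝ × ℝ, 0 < p.1 → 0 < p.2 → R p ≤ E p
  E_le : ∀ p : ℝ × ℝ, 0 < p.1 → 0 < p.2 → E p ≤ m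
  E_le_mul : ∀ p : ℝ × ℝ, 0 < p.1 → 0 < p.2 → E p ≤ K * p.1
  le_add : ∀ p : ℝ × ℝ, 0 < p.1 → 0 < p.2 → G p ≤ A + m * p.2
  abs_sub_le : ∀ p : ℝ × ℝ, 0 < p.1 → 0 < p.2 → |G p - g p.1| ≤ 2 * p.2
  exists_foot : ∀ p : ℝ × ℝ, 0 < p.1 → 0 < p.2 → ∃ y, p.1 ≤ y ∧ y ≤ p.1 + p.2 ∧
    |E p - (m - deriv g y)| ≤ K * p.2 ∧ |R p - (m - 2 * (g y / y) + deriv g y)| ≤ K * p.2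

theorem AdmissibleData.deriv_le {m C : ℝ} {g : ℝ → ℝ} (hg : AdmissibleData m C g) {y : ℝ}
    (hy : 0 < y) : deriv g y ≤ m := by
  have h1 := hg.two_mul_le y hy
  have h2 := hg.mul_deriv_le y hy
  exact le_of_mul_le_mul_left (by linarith : y * deriv g y ≤ y * m) hy

theorem AdmissibleData.abs_sub_le {m C : ℝ} {g : ℝ → ℝ} (hg : AdmissibleData m C g) {y z : ℝ}
    (hy : 0 < y) (hz : 0 < z) : |g z - g y| ≤ m * |z - y| := by
  refine (convex_Ioi (0 : ℝ)).norm_image_sub_le_of_norm_deriv_le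
    (fun w hw => (hg.contDiffAt w hw).differentiableAt (by simp)) (fun w hw => ?_) hy hz
  rw [Real.norm_of_nonneg (hg.deriv_nonneg w hw)]
  exact hg.deriv_le hw

namespace IsCharacteristicFlow

variable {m C : ℝ} {g : ℝ → ℝ} {e r x t : ℝ → ℝ → ℝ} {y τ : ℝ}

theorem hasFDerivAt_value {Ψ : ℝ × ℝ → ℝ × ℝ} {p : ℝ × ℝ}
    (h : IsCharacteristicFlow m g e r x t) (hg : AdmissibleData m C g)
    (hp1 : 0 < (Ψ p).1) (hp2 : 0 < (Ψ p).2) (hΨ : ContDiffAt ℝ ∞ Ψ p)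
    (hΨr : ∀ᶠ q in 𝓝 p, (x (Ψ q).1 (Ψ q).2, t (Ψ q).1 (Ψ q).2) = q) :
    HasFDerivAt (fun q => x (Ψ q).1 (Ψ q).2 *
        (m - (e (Ψ q).1 (Ψ q).2 + r (Ψ q).1 (Ψ q).2) / 2))
      ((m - e (Ψ p).1 (Ψ p).2) • .fst ℝ ℝ ℝ
        + ((r (Ψ p).1 (Ψ p).2 - e (Ψ p).1 (Ψ p).2 ^ 2) / 2) • .snd ℝ ℝ ℝ) p := by
  obtain ⟨-, δe, δr, δx, δt, -, hc, hd⟩ := h.exists_fderiv_apply_eq hg hp1 hp2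
  have hΨd := (hΨ.differentiableAt (by simp)).hasFDerivAt
  have hU := HasFDerivAt.comp p (hf := hΨd) (hg := hd)
  simp only [Function.comp_def] at hU
  have hx := hU.snd.snd.fst
  have hid := (hx.prodMk hU.snd.snd.snd).congr_of_eventuallyEq
    (f₁ := fun q => q) (hΨr.mono fun q hq => hq.symm)
  have hZ := hx.mul (((hU.fst.add hU.snd.fst).mul_const (2⁻¹ : ℝ)).const_sub m)
  refine (hZ.congr_of_eventuallyEq (Eventually.of_forall fun q => ?_)).congr_fderiv ?_
  · simp [div_eq_mul_inv]
  refine ContinuousLinearMap.ext fun v => ?_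
  obtain ⟨hv1, hv2⟩ := Prod.ext_iff.1 (DFunLike.congr_fun (hid.unique (hasFDerivAt_id p)) v)
  simp at hv1 hv2
  simp
  generalize (fderiv ℝ Ψ p v) = w at *
  rw [← hv1, ← hv2]
  linear_combination w.1 * hc

theorem exists_contDiffAt_foot (h : IsCharacteristicFlow m g e r x t)
    (hg : AdmissibleData m C g) : ∃ Ξ : ℝ × ℝ → ℝ × ℝ, ∀ p : ℝ × ℝ, 0 < p.1 → 0 < p.2 →
      (0 < (Ξ p).1 ∧ 0 < (Ξ p).2) ∧ (x (Ξ p).1 (Ξ p).2, t (Ξ p).1 (Ξ p).2) = p ∧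
      ContDiffAt ℝ ∞ Ξ p := by
  have hex : ∀ p : ℝ × ℝ, ∃ P : ℝ × ℝ, 0 < p.1 → 0 < p.2 → (0 < P.1 ∧ 0 < P.2) ∧
      (x P.1 P.2, t P.1 P.2) = p := fun p => by
    by_cases hp : 0 < p.1 ∧ 0 < p.2
    · obtain ⟨P, hP, -⟩ := h.existsUnique_foot hg hp.1 hp.2
      exact ⟨P, fun _ _ => ⟨hP.1, Prod.ext hP.2.1 hP.2.2⟩⟩
    · exact ⟨0, fun h1 h2 => absurd ⟨h1, h2⟩ hp⟩
  choose Ξ hΞ using hex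
  refine ⟨Ξ, fun p hp1 hp2 => ⟨(hΞ p hp1 hp2).1, (hΞ p hp1 hp2).2, ?_⟩⟩
  obtain ⟨⟨hP1, hP2⟩, hPp⟩ := hΞ p hp1 hp2
  obtain ⟨hsm, δe, δr, δx, δt, hJ, -, hd⟩ := h.exists_fderiv_apply_eq hg hP1 hP2
  have hx := (h.isCharacteristic _ hP1).x_pos _ hP2.le
  have hinj : ∀ v, fderiv ℝ (fun P : ℝ × ℝ => (x P.1 P.2, t P.1 P.2)) (Ξ p) v = 0 → v = 0 := by
    intro v hv
    have hΦd := (hd.snd.snd.fst.prodMk hd.snd.snd.snd).fderiv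
    simp only [Prod.mk.eta] at hΦd
    rw [hΦd] at hv
    simp at hv
    obtain ⟨hv1, hv2⟩ := hv
    have hv3 : v.1 * (δx + (e (Ξ p).1 (Ξ p).2 + 1 / 2) * δt) = 0 := by
      linear_combination hv1 + (e (Ξ p).1 (Ξ p).2 + 1 / 2) * hv2
    have hv4 := (mul_eq_zero.1 hv3).resolve_right hJ.ne'
    rw [hv4, zero_mul, zero_add] at hv2
    exact Prod.ext hv4 ((mul_eq_zero.1 hv2).resolve_right hx.ne')
  obtain ⟨Ψ, hΨ0, hΨ, hΨr⟩ := ContDiffAt.exists_local_right_inverse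
    (hsm.snd.snd.fst.prodMk hsm.snd.snd.snd) hinj
  simp only at hΨ0 hΨ hΨr
  rw [hPp] at hΨ0 hΨ hΨr
  refine hΨ.congr_of_eventuallyEq ?_
  have hΨc := hΨ.continuousAt
  have e1 : ∀ᶠ q in 𝓝 p, 0 < (Ψ q).1 :=
    hΨc.fst.eventually_const_lt (by beta_reduce; rw [hΨ0]; exact hP1)
  have e2 : ∀ᶠ q in 𝓝 p, 0 < (Ψ q).2 :=
    hΨc.snd.eventually_const_lt (by beta_reduce; rw [hΨ0]; exact hP2)
  filter_upwards [e1, e2, hΨr, continuousAt_fst.eventually_const_lt hp1,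
    continuousAt_snd.eventually_const_lt hp2] with q h1 h2 h3 h4 h5
  have h6 := hΞ q h4 h5
  exact (h.existsUnique_foot hg h4 h5).unique
    ⟨h6.1, (Prod.ext_iff.1 h6.2).1, (Prod.ext_iff.1 h6.2).2⟩
    ⟨⟨h1, h2⟩, (Prod.ext_iff.1 h3).1, (Prod.ext_iff.1 h3).2⟩

end IsCharacteristicFlow

theorem AdmissibleData.exists_isClassicalSolution {m C : ℝ} {g : ℝ → ℝ} (hm : m < 1 / 2)
    (hC : 0 < C) (hg : AdmissibleData m C g) :
    ∃ G E R : ℝ × ℝ → ℝ, IsClassicalSolution m C (C * Real.exp 4) g G E R := by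
  obtain ⟨e, r, x, t, h⟩ := hg.exists_isCharacteristicFlow (by linarith)
  obtain ⟨Ξ, hΞ⟩ := h.exists_contDiffAt_foot hg
  have hr : ∀ p : ℝ × ℝ, 0 < p.1 → 0 < p.2 →
      ∀ᶠ q in 𝓝 p, (x (Ξ q).1 (Ξ q).2, t (Ξ q).1 (Ξ q).2) = q := fun p hp1 hp2 => by
    filter_upwards [continuousAt_fst.eventually_const_lt hp1,
      continuousAt_snd.eventually_const_lt hp2] with q h1 h2
    exact (hΞ q h1 h2).2.1
  have hz : ∀ y, 0 < y → x y 0 * (m - (e y 0 + r y 0) / 2) = g y := fun y hy => by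
    rw [h.x_zero y hy, h.e_zero y hy, h.r_zero y hy]
    field_simp
    ring
  have heK : ∀ y, 0 < y → ∀ τ, 0 ≤ τ → e y τ ≤ C * Real.exp 4 * x y τ := fun y hy τ hτ => by
    refine (h.isCharacteristic y hy).e_le_mul hm hC ?_ hτ
    rw [h.x_zero y hy, h.e_zero y hy, h.r_zero y hy]
    have h1 := hg.mul_sub_le y hy
    have h2 : y * (g y / y) = g y := by field_simp
    exact le_of_mul_le_mul_left (by linarith) hy
  refine ⟨fun q => x (Ξ q).1 (Ξ q).2 * (m - (e (Ξ q).1 (Ξ q).2 + r (Ξ q).1 (Ξ q).2) / 2),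
    fun q => e (Ξ q).1 (Ξ q).2, fun q => r (Ξ q).1 (Ξ q).2, ?_, ?_, ?_, ?_, ?_, ?_, ?_, ?_, ?_,
    ?_⟩ <;> intro p hp1 hp2 <;> obtain ⟨⟨hP1, hP2⟩, hPp, hΞp⟩ := hΞ p hp1 hp2 <;>
    have hc := h.isCharacteristic _ hP1 <;> obtain ⟨hPx, hPt⟩ := Prod.ext_iff.1 hPp <;>
    simp only at hPx hPt
  · obtain ⟨hsm, -⟩ := h.exists_fderiv_apply_eq hg hP1 hP2
    have hU := ContDiffAt.comp p (g := fun P : ℝ × ℝ =>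
      (e P.1 P.2, r P.1 P.2, x P.1 P.2, t P.1 P.2)) (f := Ξ) hsm hΞp
    exact hU.snd.snd.fst.mul (contDiffAt_const.sub
      ((hU.fst.add hU.snd.fst).div_const 2))
  · exact h.hasFDerivAt_value hg hP1 hP2 hΞp (hr p hp1 hp2)
  · simp only [hPx]
  · exact hc.r_nonneg _ hP2.le
  · exact hc.r_le_e _ hP2.le
  · exact hc.e_le _ hP2.le
  · simpa only [hPx] using heK _ hP1 _ hP2.le
  · have h1 := hc.value_le hP2.le
    have h2 := hg.le_const _ hP1
    rw [hz _ hP1, hPt] at h1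
    linarith
  · have h1 := hc.abs_value_sub_le hm.le hP2.le
    have h2 := hg.abs_sub_le hp1 hP1
    have h3 := hc.sub_le hP2.le
    have h4 := hc.x_le hP2.le
    have hm0 : 0 ≤ m := (hc.e_nonneg le_rfl).trans (hc.e_le 0 le_rfl)
    rw [hz _ hP1, hPt] at h1
    rw [h.x_zero _ hP1, hPx] at h3 h4
    rw [hPt] at h3
    rw [abs_of_nonneg (by linarith : 0 ≤ (Ξ p).1 - p.1)] at h2
    have h5 : m * ((Ξ p).1 - p.1) ≤ 1 * p.2 :=
      mul_le_mul (by linarith) (by nlinarith) (by linarith) zero_le_one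
    calc _ ≤ _ := _root_.abs_sub_le _ (g (Ξ p).1) _
      _ ≤ 2 * p.2 := by linarith
  · have h1 := hc.e_zero_sub_le (heK _ hP1) hP2.le
    have h2 := hc.r_zero_sub_le (by linarith) (heK _ hP1) hP2.le
    have h3 := hc.sub_le hP2.le
    have h4 := hc.x_le hP2.le
    rw [h.x_zero _ hP1, hPx] at h3 h4
    rw [hPt] at h3
    rw [h.e_zero _ hP1, hPt, abs_sub_comm] at h1
    rw [h.r_zero _ hP1, hPt, abs_sub_comm] at h2
    exact ⟨(Ξ p).1, h4, by nlinarith, h1, h2⟩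

end ClassicalSolution

section Comparison

open scoped Topology ContDiff

theorem exists_contDiff_eventuallyEq {E : Type*} [NormedAddCommGroup E] [NormedSpace ℝ E]
    [FiniteDimensional ℝ E] {H : E → ℝ} {p : E} (hH : ∀ᶠ q in 𝓝 p, ContDiffAt ℝ 1 H q) :
    ∃ φ : E → ℝ, ContDiff ℝ 1 φ ∧ φ =ᶠ[𝓝 p] H := by
  obtain ⟨δ, hδ, hball⟩ := Metric.nhds_basis_closedBall.eventually_iff.1 hH
  let f : ContDiffBump p := ⟨δ / 2, δ, by positivity, by linarith⟩
  refine ⟨fun q => f q * H q, contDiff_iff_contDiffAt.2 fun q => ?_, ?_⟩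
  · by_cases hq : q ∈ tsupport f
    · exact f.contDiffAt.mul (hball (f.tsupport_eq ▸ hq))
    · refine (contDiffAt_const (c := (0 : ℝ))).congr_of_eventuallyEq ?_
      filter_upwards [notMem_tsupport_iff_eventuallyEq.1 hq] with z hz
      simp [hz]
  · filter_upwards [f.eventuallyEq_one] with q hq
    simp [hq]

theorem HasFDerivAt.deriv_fst_eq {H : ℝ × ℝ → ℝ} {p : ℝ × ℝ} {a b : ℝ}
    (hd : HasFDerivAt H (a • .fst ℝ ℝ ℝ + b • .snd ℝ ℝ ℝ) p) :
    deriv (fun y => H (y, p.2)) p.1 = a := by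
  have := HasFDerivAt.comp_hasDerivAt p.1 (l := H) (f := fun y => (y, p.2)) hd
    ((hasDerivAt_id p.1).prodMk (hasDerivAt_const p.1 p.2))
  exact this.deriv.trans (by simp)

theorem HasFDerivAt.deriv_snd_eq {H : ℝ × ℝ → ℝ} {p : ℝ × ℝ} {a b : ℝ}
    (hd : HasFDerivAt H (a • .fst ℝ ℝ ℝ + b • .snd ℝ ℝ ℝ) p) :
    deriv (fun s => H (p.1, s)) p.2 = b := by
  have := HasFDerivAt.comp_hasDerivAt p.2 (l := H) (f := fun s => (p.1, s)) hd
    ((hasDerivAt_const p.2 p.1).prodMk (hasDerivAt_id p.2))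
  exact this.deriv.trans (by simp)

variable {m : ℝ} {F : ℝ → ℝ → ℝ} {H : ℝ × ℝ → ℝ} {p : ℝ × ℝ} {a b : ℝ}

theorem IsSubsolutionHJ.le_of_isLocalMax (h : IsSubsolutionHJ m F) (hp1 : 0 < p.1)
    (hp2 : 0 < p.2) (hH : ∀ᶠ q in 𝓝 p, ContDiffAt ℝ 1 H q)
    (hmax : IsLocalMax (fun q : ℝ × ℝ => F q.1 q.2 - H q) p)
    (hd : HasFDerivAt H (a • .fst ℝ ℝ ℝ + b • .snd ℝ ℝ ℝ) p) :
    b + (1 / 2) * (a - m) * (a - m - 1) + F p.1 p.2 / p.1 - m ≤ 0 := by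
  obtain ⟨φ, hφ, hφH⟩ := exists_contDiff_eventuallyEq hH
  have hdφ := hd.congr_of_eventuallyEq hφH
  have := h φ hφ p.1 p.2 hp1 hp2 (IsLocalMax.on (by
    filter_upwards [hmax, hφH] with q h1 h2
    simp only [h2, Prod.mk.eta, hφH.self_of_nhds]
    exact h1) _)
  rwa [hdφ.deriv_fst_eq, hdφ.deriv_snd_eq] at this

theorem IsSupersolutionHJ.ge_of_isLocalMin (h : IsSupersolutionHJ m F) (hp1 : 0 < p.1)
    (hp2 : 0 < p.2) (hH : ∀ᶠ q in 𝓝 p, ContDiffAt ℝ 1 H q)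
    (hmin : IsLocalMin (fun q : ℝ × ℝ => F q.1 q.2 - H q) p)
    (hd : HasFDerivAt H (a • .fst ℝ ℝ ℝ + b • .snd ℝ ℝ ℝ) p) :
    b + (1 / 2) * (a - m) * (a - m - 1) + F p.1 p.2 / p.1 - m ≥ 0 := by
  obtain ⟨φ, hφ, hφH⟩ := exists_contDiff_eventuallyEq hH
  have hdφ := hd.congr_of_eventuallyEq hφH
  have := h φ hφ p.1 p.2 hp1 hp2 (IsLocalMin.on (by
    filter_upwards [hmin, hφH] with q h1 h2
    simp only [h2, Prod.mk.eta, hφH.self_of_nhds]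
    exact h1) _)
  rwa [hdφ.deriv_fst_eq, hdφ.deriv_snd_eq] at this

/-- A penalized function on the open quadrant attains a positive maximum. -/
theorem exists_isMaxOn_sub_exp {D : ℝ × ℝ → ℝ} {L M ε : ℝ} (hm : 0 < m) (hL : 0 < L) (hM : 0 < M)
    (hε : 0 < ε) (hD : ContinuousOn D (Ioi 0 ×ˢ Ioi 0))
    (hDx : ∀ q ∈ Ioi (0 : ℝ) ×ˢ Ioi (0 : ℝ), D q ≤ m * q.1)
    (hDt : ∀ q ∈ Ioi (0 : ℝ) ×ˢ Ioi (0 : ℝ), D q ≤ L * q.2)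
    (hDM : ∀ q ∈ Ioi (0 : ℝ) ×ˢ Ioi (0 : ℝ), D q ≤ M * (1 + q.2)) {p₀ : ℝ × ℝ}
    (hp₀ : p₀ ∈ Ioi (0 : ℝ) ×ˢ Ioi (0 : ℝ))
    (hpos : 0 < D p₀ - ε * Real.exp (2 * p₀.2) * (p₀.1 + 1)) :
    ∃ p ∈ Ioi (0 : ℝ) ×ˢ Ioi (0 : ℝ),
      0 < D p - ε * Real.exp (2 * p.2) * (p.1 + 1) ∧
      IsMaxOn (fun q => D q - ε * Real.exp (2 * q.2) * (q.1 + 1)) (Ioi 0 ×ˢ Ioi 0) p := by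
  set W : ℝ × ℝ → ℝ := fun q => D q - ε * Real.exp (2 * q.2) * (q.1 + 1) with hW
  set w := W p₀
  have hw : 0 < w := hpos
  set S : Set (ℝ × ℝ) := Icc (w / m) (M ^ 2 / ε ^ 2) ×ˢ Icc (w / L) (M / ε) with hS
  have hSsub : S ⊆ Ioi 0 ×ˢ Ioi 0 := fun q hq =>
    ⟨(by positivity : 0 < w / m).trans_le hq.1.1, (by positivity : 0 < w / L).trans_le hq.2.1⟩
  have hmem : ∀ q ∈ Ioi (0 : ℝ) ×ˢ Ioi (0 : ℝ), w ≤ W q → q ∈ S := by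
    intro q hq hwq
    have hq1 : 0 < q.1 := hq.1
    have hq2 : 0 < q.2 := hq.2
    have h0 : 0 ≤ ε * Real.exp (2 * q.2) * (q.1 + 1) := by positivity
    have h1 : w + ε * Real.exp (2 * q.2) * (q.1 + 1) ≤ D q := by simp only [hW] at hwq; linarith
    have h2 : (1 + q.2) ^ 2 ≤ Real.exp (2 * q.2) := by
      rw [two_mul, Real.exp_add, ← sq]
      exact pow_le_pow_left₀ (by linarith) (by linarith [Real.add_one_le_exp q.2]) 2
    have h3 : ε * (1 + q.2) ^ 2 * (q.1 + 1) ≤ M * (1 + q.2) := by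
      have : ε * (1 + q.2) ^ 2 * (q.1 + 1) ≤ ε * Real.exp (2 * q.2) * (q.1 + 1) := by gcongr
      linarith [hDM q hq]
    have h4 : ε * (1 + q.2) * (q.1 + 1) ≤ M :=
      le_of_mul_le_mul_right (by linarith) (by linarith : 0 < 1 + q.2)
    have h5 : ε * q.2 ≤ M := by nlinarith [mul_pos hε hq1, mul_pos (mul_pos hε hq1) hq2]
    have h6 : ε * (q.1 + 1) ≤ M := by nlinarith [mul_pos hε hq2, mul_pos (mul_pos hε hq1) hq2]
    refine ⟨⟨?_, ?_⟩, ?_, ?_⟩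
    · rw [div_le_iff₀ hm]; linarith [hDx q hq]
    · rw [le_div_iff₀ (by positivity)]
      nlinarith [mul_pos hε hq1]
    · rw [div_le_iff₀ hL]; linarith [hDt q hq]
    · rw [le_div_iff₀ hε]; linarith
  have hcont : ContinuousOn W S := (hD.mono hSsub).sub (by fun_prop)
  obtain ⟨p, hp, hmax⟩ := (isCompact_Icc.prod isCompact_Icc).exists_isMaxOn
    ⟨p₀, hmem p₀ hp₀ le_rfl⟩ hcont
  have hwp : w ≤ W p := hmax (hmem p₀ hp₀ le_rfl)
  refine ⟨p, hSsub hp, hw.trans_le hwp, fun q hq => ?_⟩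
  rcases le_or_gt w (W q) with h | h
  · exact hmax (hmem q hq h)
  · exact h.le.trans hwp

end Comparison

section Uniqueness

open scoped Topology ContDiff

theorem hasFDerivAt_exp_mul_add (ε : ℝ) (p : ℝ × ℝ) :
    HasFDerivAt (fun q : ℝ × ℝ => ε * Real.exp (2 * q.2) * (q.1 + 1))
      ((ε * Real.exp (2 * p.2)) • .fst ℝ ℝ ℝ
        + (2 * (ε * Real.exp (2 * p.2)) * (p.1 + 1)) • .snd ℝ ℝ ℝ) p := by
  have := (((hasFDerivAt_snd (𝕜 := ℝ) (p := p)).const_mul 2).exp.const_mul ε).mul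
    ((hasFDerivAt_fst (𝕜 := ℝ) (p := p)).add_const 1)
  refine this.congr_fderiv ?_
  ext
  · simp
  · simp
    ring

namespace IsClassicalSolution

variable {m A K : ℝ} {g : ℝ → ℝ} {G E R : ℝ × ℝ → ℝ} {F : ℝ → ℝ → ℝ}

theorem eventually_contDiffAt (hG : IsClassicalSolution m A K g G E R) {p : ℝ × ℝ}
    (hp1 : 0 < p.1) (hp2 : 0 < p.2) : ∀ᶠ q in 𝓝 p, ContDiffAt ℝ 1 G q := by
  filter_upwards [prod_mem_nhds (Ioi_mem_nhds hp1) (Ioi_mem_nhds hp2)] with q hq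
  exact (hG.contDiffAt q hq.1 hq.2).of_le (by simp)

theorem continuousOn (hG : IsClassicalSolution m A K g G E R) :
    ContinuousOn G (Ioi 0 ×ˢ Ioi 0) := fun p hp =>
  (hG.contDiffAt p hp.1 hp.2).continuousAt.continuousWithinAt

theorem nonneg (hG : IsClassicalSolution m A K g G E R) {p : ℝ × ℝ} (hp1 : 0 < p.1)
    (hp2 : 0 < p.2) : 0 ≤ G p := by
  rw [hG.eq_mul p hp1 hp2]
  have := hG.E_le p hp1 hp2
  have := hG.R_le_E p hp1 hp2
  exact mul_nonneg hp1.le (by linarith)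

theorem le_mul (hG : IsClassicalSolution m A K g G E R) {p : ℝ × ℝ} (hp1 : 0 < p.1)
    (hp2 : 0 < p.2) : G p ≤ m * p.1 := by
  rw [hG.eq_mul p hp1 hp2]
  have := hG.R_nonneg p hp1 hp2
  have := hG.R_le_E p hp1 hp2
  nlinarith

theorem ge_of_isSubsolutionHJ (hG : IsClassicalSolution m A K g G E R) (hm₀ : 0 < m)
    (hm₁ : m < 1 / 2) {L M : ℝ} (hL : 0 < L) (hM : 0 < M)
    (hF : IsSubsolutionHJ m F)
    (hFc : ContinuousOn (fun q : ℝ × ℝ => F q.1 q.2) (Ioi 0 ×ˢ Ioi 0))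
    (hFx : ∀ q ∈ Ioi (0 : ℝ) ×ˢ Ioi (0 : ℝ), F q.1 q.2 ≤ m * q.1)
    (hFg : ∀ q ∈ Ioi (0 : ℝ) ×ˢ Ioi (0 : ℝ), F q.1 q.2 ≤ g q.1 + L * q.2)
    (hFM : ∀ q ∈ Ioi (0 : ℝ) ×ˢ Ioi (0 : ℝ), F q.1 q.2 ≤ M * (1 + q.2))
    {p₀ : ℝ × ℝ} (hp₀ : p₀ ∈ Ioi (0 : ℝ) ×ˢ Ioi (0 : ℝ)) : F p₀.1 p₀.2 ≤ G p₀ := by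
  by_contra! hlt
  have hc : 0 < Real.exp (2 * p₀.2) * (p₀.1 + 1) := by
    have : 0 < p₀.1 := hp₀.1
    positivity
  set ε := (F p₀.1 p₀.2 - G p₀) / (2 * (Real.exp (2 * p₀.2) * (p₀.1 + 1))) with hε_def
  have hε : 0 < ε := div_pos (by linarith) (by linarith)
  have hpos : 0 < F p₀.1 p₀.2 - G p₀ - ε * Real.exp (2 * p₀.2) * (p₀.1 + 1) := by
    have : ε * (2 * (Real.exp (2 * p₀.2) * (p₀.1 + 1))) = F p₀.1 p₀.2 - G p₀ :=
      div_mul_cancel₀ _ (by linarith)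
    linarith
  obtain ⟨p, hp, hWp, hmax⟩ := exists_isMaxOn_sub_exp (D := fun q => F q.1 q.2 - G q)
    (L := L + 2) hm₀ (by linarith) hM hε (hFc.sub hG.continuousOn)
    (fun q hq => by linarith [hFx q hq, hG.nonneg hq.1 hq.2])
    (fun q hq => by linarith [hFg q hq, (abs_le.1 (hG.abs_sub_le q hq.1 hq.2)).1])
    (fun q hq => by linarith [hFM q hq, hG.nonneg hq.1 hq.2]) hp₀ hpos
  have hp1 : 0 < p.1 := hp.1
  have hp2 : 0 < p.2 := hp.2
  set k := ε * Real.exp (2 * p.2) with hk_def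
  have hk : 0 < k := by positivity
  have hd := ((hG.hasFDerivAt p hp1 hp2).add (hasFDerivAt_exp_mul_add ε p)).congr_fderiv
    (g' := (m - E p + k) • .fst ℝ ℝ ℝ
      + ((R p - E p ^ 2) / 2 + 2 * k * (p.1 + 1)) • .snd ℝ ℝ ℝ) (by ext <;> simp [k])
  have hloc : IsLocalMax (fun q : ℝ × ℝ => F q.1 q.2 -
      (G q + ε * Real.exp (2 * q.2) * (q.1 + 1))) p := by
    filter_upwards [prod_mem_nhds (Ioi_mem_nhds hp1) (Ioi_mem_nhds hp2)] with q hq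
    have := hmax hq
    simp only [mem_ofPred_eq] at this
    linarith
  have hH : ∀ᶠ q in 𝓝 p, ContDiffAt ℝ 1
      (fun q => G q + ε * Real.exp (2 * q.2) * (q.1 + 1)) q :=
    (hG.eventually_contDiffAt hp1 hp2).mono fun q hq => hq.add (by fun_prop)
  have key := hF.le_of_isLocalMax hp1 hp2 hH hloc hd
  have hFk : k * (p.1 + 1) + G p < F p.1 p.2 := by linarith
  have hFG : G p / p.1 + k ≤ F p.1 p.2 / p.1 := by
    rw [div_add' _ _ _ hp1.ne']
    gcongr
    linarith
  have hGp : G p / p.1 = m - (E p + R p) / 2 := by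
    rw [hG.eq_mul p hp1 hp2]; field_simp
  have hE := hG.E_le p hp1 hp2
  nlinarith [mul_pos hk hp1, mul_nonneg hk.le (sub_nonneg.2 hE), mul_pos hk (sub_pos.2 hm₁),
    sq_nonneg k]

theorem le_of_isSupersolutionHJ (hG : IsClassicalSolution m A K g G E R) (hm₀ : 0 < m)
    (hm₁ : m < 1 / 2) {L : ℝ} (hL : 0 < L) (hA : 0 < A)
    (hF : IsSupersolutionHJ m F)
    (hFc : ContinuousOn (fun q : ℝ × ℝ => F q.1 q.2) (Ioi 0 ×ˢ Ioi 0))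
    (hFx : ∀ q ∈ Ioi (0 : ℝ) ×ˢ Ioi (0 : ℝ), 0 ≤ F q.1 q.2)
    (hFg : ∀ q ∈ Ioi (0 : ℝ) ×ˢ Ioi (0 : ℝ), g q.1 - L * q.2 ≤ F q.1 q.2)
    {p₀ : ℝ × ℝ} (hp₀ : p₀ ∈ Ioi (0 : ℝ) ×ˢ Ioi (0 : ℝ)) : G p₀ ≤ F p₀.1 p₀.2 := by
  by_contra! hlt
  have hc : 0 < Real.exp (2 * p₀.2) * (p₀.1 + 1) := by
    have : 0 < p₀.1 := hp₀.1
    positivity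
  set ε := (G p₀ - F p₀.1 p₀.2) / (2 * (Real.exp (2 * p₀.2) * (p₀.1 + 1))) with hε_def
  have hε : 0 < ε := div_pos (by linarith) (by linarith)
  have hpos : 0 < G p₀ - F p₀.1 p₀.2 - ε * Real.exp (2 * p₀.2) * (p₀.1 + 1) := by
    have : ε * (2 * (Real.exp (2 * p₀.2) * (p₀.1 + 1))) = G p₀ - F p₀.1 p₀.2 :=
      div_mul_cancel₀ _ (by linarith)
    linarith
  obtain ⟨p, hp, hWp, hmax⟩ := exists_isMaxOn_sub_exp (D := fun q => G q - F q.1 q.2)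
    (L := L + 2) (M := A + m) hm₀ (by linarith) (by linarith) hε (hG.continuousOn.sub hFc)
    (fun q hq => by linarith [hFx q hq, hG.le_mul hq.1 hq.2])
    (fun q hq => by linarith [hFg q hq, (abs_le.1 (hG.abs_sub_le q hq.1 hq.2)).2])
    (fun q hq => by nlinarith [hFx q hq, hG.le_add q hq.1 hq.2, mul_pos hA hq.2]) hp₀ hpos
  have hp1 : 0 < p.1 := hp.1
  have hp2 : 0 < p.2 := hp.2
  set k := ε * Real.exp (2 * p.2) with hk_def
  have hk : 0 < k := by positivity
  have hd := ((hG.hasFDerivAt p hp1 hp2).sub (hasFDerivAt_exp_mul_add ε p)).congr_fderiv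
    (g' := (m - E p - k) • .fst ℝ ℝ ℝ
      + ((R p - E p ^ 2) / 2 - 2 * k * (p.1 + 1)) • .snd ℝ ℝ ℝ) (by ext <;> simp [k])
  have hloc : IsLocalMin (fun q : ℝ × ℝ => F q.1 q.2 -
      (G q - ε * Real.exp (2 * q.2) * (q.1 + 1))) p := by
    filter_upwards [prod_mem_nhds (Ioi_mem_nhds hp1) (Ioi_mem_nhds hp2)] with q hq
    have := hmax hq
    simp only [mem_ofPred_eq] at this
    linarith
  have hH : ∀ᶠ q in 𝓝 p, ContDiffAt ℝ 1
      (fun q => G q - ε * Real.exp (2 * q.2) * (q.1 + 1)) q :=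
    (hG.eventually_contDiffAt hp1 hp2).mono fun q hq => hq.sub (by fun_prop)
  have key := hF.ge_of_isLocalMin hp1 hp2 hH hloc hd
  have hFk : k * (p.1 + 1) + F p.1 p.2 < G p := by linarith
  have hkm : k ≤ m := by
    have := hG.le_mul hp1 hp2
    have := hFx p hp
    exact le_of_mul_le_mul_right (by linarith : k * p.1 ≤ m * p.1) hp1
  have hFG : F p.1 p.2 / p.1 + k ≤ G p / p.1 := by
    rw [div_add' _ _ _ hp1.ne']
    gcongr
    linarith
  have hGp : G p / p.1 = m - (E p + R p) / 2 := by
    rw [hG.eq_mul p hp1 hp2]; field_simp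
  have hE := hG.E_le p hp1 hp2
  nlinarith [mul_pos hk hp1, mul_nonneg hk.le (sub_nonneg.2 hE), mul_pos hk (sub_pos.2 hm₁),
    mul_nonneg hk.le (sub_nonneg.2 hkm)]

end IsClassicalSolution

/-- Uniqueness of good solutions whose initial data admit a classical solution. -/
theorem GoodSolution.eqOn {m A K : ℝ} {g : ℝ → ℝ} {G E R : ℝ × ℝ → ℝ} {F : ℝ → ℝ → ℝ}
    (hF : GoodSolution m g F) (hG : IsClassicalSolution m A K g G E R)
    (hgA : ∀ x, 0 < x → g x ≤ A) (hm₀ : 0 < m) (hm₁ : m < 1 / 2) (hA : 0 < A) :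
    EqOn (fun q : ℝ × ℝ => F q.1 q.2) G (Ioi 0 ×ˢ Ioi 0) := by
  obtain ⟨⟨L, hL⟩, -, hFx, hF0, hsub, hsup⟩ := hF
  have hFg : ∀ q ∈ Ioi (0 : ℝ) ×ˢ Ioi (0 : ℝ), |F q.1 q.2 - g q.1| ≤ L * q.2 := by
    intro q hq
    have hq1 : 0 < q.1 := hq.1
    have hq2 : 0 < q.2 := hq.2
    have := hL.dist_le_mul q ⟨hq1.le, hq2.le⟩ (q.1, 0) ⟨hq1.le, le_refl (0 : ℝ)⟩
    simpa [Real.dist_eq, hF0 q.1 hq1.le, Prod.dist_eq, abs_of_pos hq2, hq2.le] using this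
  have hFc : ContinuousOn (fun q : ℝ × ℝ => F q.1 q.2) (Ioi 0 ×ˢ Ioi 0) :=
    hL.continuousOn.mono (prod_mono Ioi_subset_Ici_self Ioi_subset_Ici_self)
  have hL0 : (0 : ℝ) ≤ L := L.2
  have hle : ∀ q ∈ Ioi (0 : ℝ) ×ˢ Ioi (0 : ℝ), |F q.1 q.2 - g q.1| ≤ (L + 1) * q.2 :=
    fun q hq => (hFg q hq).trans (by linarith [mem_Ioi.1 hq.2])
  refine fun p hp => le_antisymm ?_ ?_
  · refine hG.ge_of_isSubsolutionHJ hm₀ hm₁ (L := L + 1) (M := A + (L + 1)) (by linarith)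
      (by linarith) hsub hFc (fun q hq => (hFx _ _ (le_of_lt hq.1) (le_of_lt hq.2)).2)
      (fun q hq => by linarith [(abs_le.1 (hle q hq)).2]) (fun q hq => ?_) hp
    nlinarith [(abs_le.1 (hle q hq)).2, hgA q.1 hq.1, mul_pos hA hq.2]
  · exact hG.le_of_isSupersolutionHJ hm₀ hm₁ (L := L + 1) (by linarith) hA hsup hFc
      (fun q hq => (hFx _ _ (le_of_lt hq.1) (le_of_lt hq.2)).1)
      (fun q hq => by linarith [(abs_le.1 (hle q hq)).1]) hp

end Uniqueness

section BoundaryRegularity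

open scoped Topology ContDiff

theorem contDiffOn_one_closure_of_tendsto_fderiv {V W : Type*} [NormedAddCommGroup V]
    [NormedSpace ℝ V] [NormedAddCommGroup W] [NormedSpace ℝ W] {f : V → W} {s : Set V}
    (hs : Convex ℝ s) (hso : IsOpen s) (hd : DifferentiableOn ℝ f s)
    (hc : ContinuousOn f (closure s))
    (h : ∀ x ∈ closure s, ∃ f' : V →L[ℝ] W, Tendsto (fderiv ℝ f) (𝓝[s] x) (𝓝 f')) :
    ContDiffOn ℝ 1 f (closure s) := by
  rw [← zero_add 1, contDiffOn_succ_iff_hasFDerivWithinAt (by simp)]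
  refine fun x hx => ⟨closure s, by rw [insert_eq_of_mem hx]; exact self_mem_nhdsWithin,
    by simp, extendFrom s (fderiv ℝ f), fun y hy => ?_,
    contDiffOn_zero.2 (continuousOn_extendFrom subset_rfl h)⟩
  exact hasFDerivWithinAt_closure_of_tendsto_fderiv hd hs hso
    (fun z hz => (hc z hz).mono subset_closure) (tendsto_extendFrom (h y hy))

namespace IsClassicalSolution

variable {m A K C : ℝ} {g : ℝ → ℝ} {G E R : ℝ × ℝ → ℝ} {p : ℝ × ℝ}

theorem tendsto_fderiv (hG : IsClassicalSolution m A K g G E R) {e r : ℝ}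
    (hE : Tendsto E (𝓝[Ioi 0 ×ˢ Ioi 0] p) (𝓝 e)) (hR : Tendsto R (𝓝[Ioi 0 ×ˢ Ioi 0] p) (𝓝 r)) :
    Tendsto (fderiv ℝ G) (𝓝[Ioi 0 ×ˢ Ioi 0] p)
      (𝓝 ((m - e) • .fst ℝ ℝ ℝ + ((r - e ^ 2) / 2) • .snd ℝ ℝ ℝ)) := by
  refine (((hE.const_sub m).smul_const _).add
    (((hR.sub (hE.pow 2)).div_const 2).smul_const _)).congr' ?_
  filter_upwards [self_mem_nhdsWithin] with q hq
  exact (hG.hasFDerivAt q hq.1 hq.2).fderiv.symm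

theorem tendsto_fderiv_of_fst_eq_zero (hG : IsClassicalSolution m A K g G E R) (hp : p.1 = 0) :
    ∃ L, Tendsto (fderiv ℝ G) (𝓝[Ioi 0 ×ˢ Ioi 0] p) (𝓝 L) := by
  have hfst : Tendsto (fun q : ℝ × ℝ => K * q.1) (𝓝[Ioi 0 ×ˢ Ioi 0] p) (𝓝 0) := by
    have : ContinuousAt (fun q : ℝ × ℝ => K * q.1) p := by fun_prop
    simpa [hp] using this.continuousWithinAt.tendsto (s := Ioi 0 ×ˢ Ioi 0)
  have hE : Tendsto E (𝓝[Ioi 0 ×ˢ Ioi 0] p) (𝓝 0) := by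
    refine squeeze_zero' ?_ ?_ hfst
    all_goals filter_upwards [self_mem_nhdsWithin] with q hq
    · exact (hG.R_nonneg q hq.1 hq.2).trans (hG.R_le_E q hq.1 hq.2)
    · exact hG.E_le_mul q hq.1 hq.2
  have hR : Tendsto R (𝓝[Ioi 0 ×ˢ Ioi 0] p) (𝓝 0) := by
    refine squeeze_zero' ?_ ?_ hE
    all_goals filter_upwards [self_mem_nhdsWithin] with q hq
    · exact hG.R_nonneg q hq.1 hq.2
    · exact hG.R_le_E q hq.1 hq.2
  exact ⟨_, hG.tendsto_fderiv hE hR⟩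

theorem tendsto_fderiv_of_snd_eq_zero (hG : IsClassicalSolution m A K g G E R)
    (hg : AdmissibleData m C g) (hp1 : 0 < p.1) (hp : p.2 = 0) :
    ∃ L, Tendsto (fderiv ℝ G) (𝓝[Ioi 0 ×ˢ Ioi 0] p) (𝓝 L) := by
  choose! Y hY using fun q : ℝ × ℝ => fun hq : q ∈ Ioi (0 : ℝ) ×ˢ Ioi (0 : ℝ) =>
    hG.exists_foot q hq.1 hq.2
  have hfst : Tendsto (fun q : ℝ × ℝ => q.1) (𝓝[Ioi 0 ×ˢ Ioi 0] p) (𝓝 p.1) :=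
    continuous_fst.continuousWithinAt.tendsto
  have hsnd : Tendsto (fun q : ℝ × ℝ => q.2) (𝓝[Ioi 0 ×ˢ Ioi 0] p) (𝓝 0) := by
    simpa [hp] using continuous_snd.continuousWithinAt.tendsto (x := p) (s := Ioi 0 ×ˢ Ioi 0)
  have hKsnd : Tendsto (fun q : ℝ × ℝ => K * q.2) (𝓝[Ioi 0 ×ˢ Ioi 0] p) (𝓝 0) := by
    simpa using hsnd.const_mul K
  have hYt : Tendsto Y (𝓝[Ioi 0 ×ˢ Ioi 0] p) (𝓝 p.1) := by
    refine tendsto_of_tendsto_of_tendsto_of_le_of_le' hfst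
      (by simpa using hfst.add hsnd) ?_ ?_
    all_goals filter_upwards [self_mem_nhdsWithin] with q hq
    · exact (hY q hq).1
    · exact (hY q hq).2.1
  have hgc := (hg.contDiffAt p.1 hp1).continuousAt.tendsto.comp hYt
  have hgd := ((hg.contDiffAt p.1 hp1).derivWithin (m := 0) (by simp)).continuousAt.tendsto.comp hYt
  have hE₀ : Tendsto (fun q => E q - (m - deriv g (Y q))) (𝓝[Ioi 0 ×ˢ Ioi 0] p) (𝓝 0) := by
    refine squeeze_zero_norm' ?_ hKsnd
    filter_upwards [self_mem_nhdsWithin] with q hq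
    exact (hY q hq).2.2.1
  have hR₀ : Tendsto (fun q => R q - (m - 2 * (g (Y q) / Y q) + deriv g (Y q)))
      (𝓝[Ioi 0 ×ˢ Ioi 0] p) (𝓝 0) := by
    refine squeeze_zero_norm' ?_ hKsnd
    filter_upwards [self_mem_nhdsWithin] with q hq
    exact (hY q hq).2.2.2
  have hE := (hE₀.add (hgd.const_sub m)).congr fun q => sub_add_cancel _ _
  have hR := (hR₀.add ((((hgc.div hYt hp1.ne').const_mul 2).const_sub m).add hgd)).congr
    fun q => sub_add_cancel _ _
  exact ⟨_, hG.tendsto_fderiv hE hR⟩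

theorem exists_tendsto_fderiv (hG : IsClassicalSolution m A K g G E R)
    (hg : AdmissibleData m C g) (hp : p ∈ Ici (0 : ℝ) ×ˢ Ici (0 : ℝ)) :
    ∃ L, Tendsto (fderiv ℝ G) (𝓝[Ioi 0 ×ˢ Ioi 0] p) (𝓝 L) := by
  rcases eq_or_lt_of_le (mem_Ici.1 hp.1) with h1 | h1
  · exact hG.tendsto_fderiv_of_fst_eq_zero h1.symm
  rcases eq_or_lt_of_le (mem_Ici.1 hp.2) with h2 | h2
  · exact hG.tendsto_fderiv_of_snd_eq_zero hg h1 h2.symm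
  · exact ⟨_, ((hG.contDiffAt p h1 h2).continuousAt_fderiv (by simp)).continuousWithinAt⟩

end IsClassicalSolution

end BoundaryRegularity

/-- Proposition 3.8, smoothness of `F` for Bernstein-transform data.
If `F₀` is the Bernstein transform of a positive measure `μ` on `(0,∞)` with first moment
`m ∈ (0,1/2)` and bounded zeroth and second moments, then the Lipschitz sublinear
viscosity solution `F` of (HJ) with initial data `F₀` belongs to
`C^∞((0,∞)×(0,∞)) ∩ C¹([0,∞)×[0,∞))`. -/
theorem smoothness_bernstein_data (m C : ℝ) (hm₀ : 0 < m) (hm₁ : m < 1 / 2) (hC : 0 < C)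
    (μ : Measure ℝ)
    (hμ_int₁ : IntegrableOn (fun s => s) (Ioi 0) μ)
    (hμ_m : (∫ s in Ioi (0 : ℝ), s ∂μ) = m)
    (hμ_zeroth : μ (Ioi 0) ≤ ENNReal.ofReal C)
    (hμ_int₂ : IntegrableOn (fun s => s ^ 2) (Ioi 0) μ)
    (hμ_second : (∫ s in Ioi (0 : ℝ), s ^ 2 ∂μ) ≤ C)
    (F₀ : ℝ → ℝ)
    (hF₀ : ∀ x : ℝ, 0 ≤ x → F₀ x = ∫ s in Ioi (0 : ℝ), (1 - Real.exp (-(s * x))) ∂μ)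
    (F : ℝ → ℝ → ℝ) (hF : GoodSolution m F₀ F) :
    ContDiffOn ℝ (⊤ : ℕ∞) (fun p : ℝ × ℝ => F p.1 p.2) (Ioi 0 ×ˢ Ioi 0) ∧
    ContDiffOn ℝ 1 (fun p : ℝ × ℝ => F p.1 p.2) (Ici 0 ×ˢ Ici 0) := by
  have hg := admissibleData_bernstein hC hμ_int₁ hμ_m hμ_zeroth hμ_int₂ hμ_second hF₀
  obtain ⟨G, E, R, hG⟩ := hg.exists_isClassicalSolution hm₁ hC
  have hFG := hF.eqOn hG hg.le_const hm₀ hm₁ hC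
  have hsmooth : ContDiffOn ℝ (⊤ : ℕ∞) (fun p : ℝ × ℝ => F p.1 p.2) (Ioi 0 ×ˢ Ioi 0) :=
    ContDiffOn.congr (fun p hp => (hG.contDiffAt p hp.1 hp.2).contDiffWithinAt) hFG
  refine ⟨hsmooth, ?_⟩
  have hopen : IsOpen (Ioi (0 : ℝ) ×ˢ Ioi (0 : ℝ)) := isOpen_Ioi.prod isOpen_Ioi
  have hcl : closure (Ioi (0 : ℝ) ×ˢ Ioi (0 : ℝ)) = Ici 0 ×ˢ Ici 0 := by
    rw [closure_prod_eq, closure_Ioi]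
  obtain ⟨L, hL⟩ := hF.1
  rw [← hcl]
  refine contDiffOn_one_closure_of_tendsto_fderiv ((convex_Ioi 0).prod (convex_Ioi 0)) hopen
    (hsmooth.differentiableOn (by simp)) (hcl ▸ hL.continuousOn) fun p hp => ?_
  obtain ⟨f', hf'⟩ := hG.exists_tendsto_fderiv hg (hcl ▸ hp)
  refine ⟨f', hf'.congr' ?_⟩
  filter_upwards [self_mem_nhdsWithin] with q hq
  exact ((hFG.eventuallyEq_of_mem (hopen.mem_nhds hq)).fderiv_eq).symm
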